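/- Let x, T > 1 and let n_x denote the prime power nearest to x. Then ∑_{0<γ≤T} x^ρ = −(Λ(n_x)/(2π)) · (e^{iT log(x/n_x)} − 1)/(i log(x/n_x)) + O( x log²(2xT) + log(2T)/log x ), where the sum runs over nontrivial zeros ρ = β + iγ of the Riemann zeta function with 0 < γ ≤ T counted with multiplicity, and where in case x = n_x the first term on the right is interpreted as −T·Λ(n_x)/(2π). The implied constant is absolute. -/

import Mathlib

open Filter MeasureTheory Real Complex Set

open Classical in
/-- Multiplicity of a point as a zero of the Riemann zeta function. -/
noncomputable def zetaZeroMult (ρ : ℂ) : ℕ :=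
  if h : AnalyticAt ℂ riemannZeta ρ then (analyticOrderAt riemannZeta ρ).toNat else 0

/-- Nontrivial zeros with imaginary part in `(0, T]`. -/
def zetaZerosUpTo (T : ℝ) : Set ℂ :=
  {ρ : ℂ | riemannZeta ρ = 0 ∧ 0 < ρ.re ∧ ρ.re < 1 ∧ 0 < ρ.im ∧ ρ.im ≤ T}

/-- `N(T)`: number of nontrivial zeros with `0 < γ ≤ T`, counted with multiplicity. -/
noncomputable def zetaN (T : ℝ) : ℕ := ∑ᶠ ρ ∈ zetaZerosUpTo T, zetaZeroMult ρ

/-- Explicit density `g` when `α = a log p / (2 π q)`. -/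
noncomputable def gPAQ (p a q : ℕ) (t : ℝ) : ℝ :=
  -(((p : ℝ) ^ ((a : ℝ) / 2) * Real.cos (2 * π * q * t) - 1) * Real.log p) /
    (π * ((p : ℝ) ^ (a : ℝ) - 2 * (p : ℝ) ^ ((a : ℝ) / 2) * Real.cos (2 * π * q * t) + 1))

/-- `α` has the special form `a log p / (2 π q)` with `p` prime, `a, q` coprime positive. -/
def IsSpecialForm (α : ℝ) (p a q : ℕ) : Prop :=
  p.Prime ∧ 0 < a ∧ 0 < q ∧ Nat.Coprime a q ∧ α = a * Real.log p / (2 * π * q)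

/-- `g` is the density `g_α` associated with `α`. -/
def IsDensityOf (α : ℝ) (g : ℝ → ℝ) : Prop :=
  (∀ p a q : ℕ, IsSpecialForm α p a q → g = gPAQ p a q) ∧
    ((¬ ∃ p a q : ℕ, IsSpecialForm α p a q) → g = 0)

/-- Sum of `h(αγ)` over zeros with `0 < γ ≤ T`, with multiplicity; `h` is `1`-periodic so this
equals the sum of `h({αγ})`. -/
noncomputable def zetaZeroSum (α : ℝ) (h : ℝ → ℂ) (T : ℝ) : ℂ :=
  ∑ᶠ ρ ∈ zetaZerosUpTo T, (zetaZeroMult ρ : ℂ) * h (α * ρ.im)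

/-- `h` is (a lift of) an absolutely continuous function on `𝕋 = ℝ/ℤ`, with derivative `h'`. -/
def IsAbsContTorus (h h' : ℝ → ℂ) : Prop :=
  Function.Periodic h 1 ∧ Function.Periodic h' 1 ∧
    (∀ a b : ℝ, IntervalIntegrable h' volume a b) ∧
    ∀ y : ℝ, h y = h 0 + ∫ t in (0:ℝ)..y, h' t

/-- `L¹` modulus of continuity on the torus. -/
noncomputable def modCont (f : ℝ → ℂ) (δ : ℝ) : ℝ :=
  sSup ((fun u => ∫ t in (0:ℝ)..1, ‖f (t + u) - f t‖) '' Set.Icc (-δ) δ)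

/-- `M_α(y;T)`. -/
noncomputable def Mfun (α y T : ℝ) : ℝ :=
  (1 / T) * (∑ᶠ ρ ∈ {ρ : ℂ | riemannZeta ρ = 0 ∧ 0 < ρ.re ∧ ρ.re < 1 ∧ 0 < ρ.im ∧ ρ.im ≤ T ∧
      Int.fract (α * ρ.im) < y}, (zetaZeroMult ρ : ℝ)) - y * (zetaN T) / T

/-- Normalized discrepancy `D*_α(T)`. -/
noncomputable def Dstar (α T : ℝ) : ℝ :=
  sSup ((fun y => (T / (zetaN T)) * |Mfun α y T|) '' Set.Icc (0:ℝ) 1)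

lemma fz_finite_zeros {f : ℂ → ℂ} (hf : Differentiable ℂ f) {z₀ : ℂ} (h0 : f z₀ ≠ 0)
    {K : Set ℂ} (hK : IsCompact K) : {z | z ∈ K ∧ f z = 0}.Finite := by
  have ha : AnalyticOnNhd ℂ f Set.univ := fun z _ => hf.analyticAt z
  have h := ha.preimage_zero_mem_codiscrete (x := z₀) h0
  have h2 := mem_codiscrete'.mp h
  have : {z | z ∈ K ∧ f z = 0} = K ∩ (f ⁻¹' {0}) := by
    ext z; simp
  rw [this]
  have hc : IsClosed (f ⁻¹' {0}) := isClosed_singleton.preimage hf.continuous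
  apply (hK.inter_right hc).finite
  have := h2.2
  simp only [Set.preimage_compl, compl_compl] at this
  exact this.mono Set.inter_subset_right

lemma fz_order_ne_top {f : ℂ → ℂ} (hf : Differentiable ℂ f) {z₀ : ℂ} (h0 : f z₀ ≠ 0) (ρ : ℂ) :
    analyticOrderAt f ρ ≠ ⊤ := by
  have ha : AnalyticOnNhd ℂ f Set.univ := fun z _ => hf.analyticAt z
  apply ha.analyticOrderAt_ne_top_of_isPreconnected isPreconnected_univ (x := z₀) trivial trivial
  rw [((hf.analyticAt z₀).analyticOrderAt_eq_zero).2 h0]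
  simp

lemma fz_factor_one {f : ℂ → ℂ} (hf : Differentiable ℂ f) {z₀ : ℂ} (h0 : f z₀ ≠ 0) (ρ : ℂ) :
    ∃ g : ℂ → ℂ, Differentiable ℂ g ∧ (∀ z, f z = (z - ρ) ^ (analyticOrderNatAt f ρ) * g z) ∧
      g ρ ≠ 0 := by
  have ht := fz_order_ne_top hf h0 ρ
  obtain ⟨g, hg, hg0, hfg⟩ := ((hf.analyticAt ρ).analyticOrderAt_ne_top).1 ht
  set m := analyticOrderNatAt f ρ
  classical
  let G : ℂ → ℂ := fun z => if z = ρ then g ρ else f z / (z - ρ) ^ m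
  have hGg : G =ᶠ[nhds ρ] g := by
    filter_upwards [hfg] with z hz
    by_cases h : z = ρ
    · simp [G, h]
    · have : (z - ρ) ^ m ≠ 0 := pow_ne_zero _ (sub_ne_zero.2 h)
      simp only [G, h, if_false, hz, smul_eq_mul]
      field_simp
  refine ⟨G, ?_, ?_, ?_⟩
  · intro z
    by_cases h : z = ρ
    · subst h
      exact (hg.differentiableAt).congr_of_eventuallyEq hGg
    · have : G =ᶠ[nhds z] fun z => f z / (z - ρ) ^ m := by
        filter_upwards [isOpen_ne.mem_nhds h] with w hw
        have hw' : w ≠ ρ := hw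
        simp [G, hw']
      refine DifferentiableAt.congr_of_eventuallyEq ?_ this
      have : (z - ρ) ^ m ≠ 0 := pow_ne_zero _ (sub_ne_zero.2 h)
      have := hf z
      fun_prop (disch := assumption)
  · intro z
    by_cases h : z = ρ
    · subst h
      have := hfg.self_of_nhds
      simpa [G] using this
    · have : (z - ρ) ^ m ≠ 0 := pow_ne_zero _ (sub_ne_zero.2 h)
      simp only [G, h, if_false]
      field_simp
  · simpa [G] using hg0

lemma fz_factor {f : ℂ → ℂ} (hf : Differentiable ℂ f) {z₀ : ℂ} (h0 : f z₀ ≠ 0) (S : Finset ℂ) :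
    ∃ g : ℂ → ℂ, Differentiable ℂ g ∧
      (∀ z, f z = (∏ ρ ∈ S, (z - ρ) ^ (analyticOrderNatAt f ρ)) * g z) ∧
      (∀ ρ ∈ S, g ρ ≠ 0) ∧ ∀ ρ ∉ S, analyticOrderAt g ρ = analyticOrderAt f ρ := by
  classical
  induction S using Finset.induction_on with
  | empty => exact ⟨f, hf, by simp, by simp, by simp⟩
  | insert a S ha ih =>
    obtain ⟨g, hg, hfg, hgS, hgo⟩ := ih
    have hg0 : g z₀ ≠ 0 := by
      intro h; apply h0; rw [hfg, h, mul_zero]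
    obtain ⟨G, hG, hgG, hGa⟩ := fz_factor_one hg hg0 a
    have hm : analyticOrderNatAt g a = analyticOrderNatAt f a := by
      unfold analyticOrderNatAt; rw [hgo a ha]
    rw [hm] at hgG
    refine ⟨G, hG, ?_, ?_, ?_⟩
    · intro z
      rw [Finset.prod_insert ha, hfg z, hgG z]; ring
    · intro ρ hρ
      rcases Finset.mem_insert.1 hρ with rfl | hρ
      · exact hGa
      · intro h
        apply hgS ρ hρ
        rw [hgG, h, mul_zero]
    · intro ρ hρ
      simp only [Finset.mem_insert, not_or] at hρ
      rw [← hgo ρ hρ.2]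
      have : g = (fun z => (z - a) ^ (analyticOrderNatAt f a)) * G := by
        ext z; simpa using hgG z
      rw [this, analyticOrderAt_mul (by fun_prop) (hG.analyticAt ρ)]
      have h1 : analyticOrderAt (fun z : ℂ => (z - a) ^ (analyticOrderNatAt f a)) ρ = 0 := by
        apply (AnalyticAt.analyticOrderAt_eq_zero (by fun_prop)).2
        exact pow_ne_zero _ (sub_ne_zero.2 hρ.1)
      rw [h1, zero_add]

lemma fz_logDeriv_factor {f g : ℂ → ℂ} (hg : Differentiable ℂ g) (S : Finset ℂ) (m : ℂ → ℕ)
    (hfg : ∀ z, f z = (∏ ρ ∈ S, (z - ρ) ^ (m ρ)) * g z) {z : ℂ} (hz : f z ≠ 0) :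
    logDeriv f z = (∑ ρ ∈ S, (m ρ : ℂ) / (z - ρ)) + logDeriv g z := by
  have hf : f = fun z => (∏ ρ ∈ S, (z - ρ) ^ (m ρ)) * g z := funext hfg
  rw [hfg] at hz
  have h1 := left_ne_zero_of_mul hz
  have h2 := right_ne_zero_of_mul hz
  rw [hf, logDeriv_mul z h1 h2 (by fun_prop) (hg z)]
  congr 1
  rw [logDeriv_prod]
  · apply Finset.sum_congr rfl
    intro ρ hρ
    rw [logDeriv_fun_pow (by fun_prop)]
    simp [logDeriv_apply, div_eq_mul_inv]
  · intro ρ hρ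
    exact (Finset.prod_ne_zero_iff.1 h1) ρ hρ
  · intro ρ hρ; fun_prop

lemma fz_max_mod {g : ℂ → ℂ} (hg : Differentiable ℂ g) {c : ℂ} {R B : ℝ} (hR : 0 < R)
    (h : ∀ z ∈ Metric.sphere c R, ‖g z‖ ≤ B) : ∀ z ∈ Metric.closedBall c R, ‖g z‖ ≤ B := by
  intro z hz
  refine Complex.norm_le_of_forall_mem_frontier_norm_le (U := Metric.ball c R)
    Metric.isBounded_ball hg.diffContOnCl ?_ ?_
  · rwa [frontier_ball c hR.ne']
  · rwa [closure_ball c hR.ne']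

/-- zero count via Blaschke factors -/
lemma fz_count {f g : ℂ → ℂ} (hg : Differentiable ℂ g) (S : Finset ℂ) (m : ℂ → ℕ) {c : ℂ} {M : ℝ}
    (hfg : ∀ z, f z = (∏ ρ ∈ S, (z - ρ) ^ (m ρ)) * g z)
    (hS : ∀ ρ ∈ S, ‖ρ - c‖ ≤ 9 / 5)
    (hM : ∀ z ∈ Metric.closedBall c (19 / 10), ‖f z‖ ≤ M) :
    (19 / 18 : ℝ) ^ (∑ ρ ∈ S, m ρ) * ‖f c‖ ≤ M := by
  let R : ℝ := 19 / 10
  let h : ℂ → ℂ := fun z =>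
    (∏ ρ ∈ S, (((R:ℂ) ^ 2 - (starRingEnd ℂ) (ρ - c) * (z - c)) / R) ^ (m ρ)) * g z
  have hh : Differentiable ℂ h := by
    intro z
    have := hg z
    simp only [h]
    fun_prop
  have key : ∀ z ∈ Metric.closedBall c R, ‖h z‖ ≤ M := by
    apply fz_max_mod hh (by norm_num [R])
    intro z hz
    have hz' : ‖z - c‖ = R := by simpa [dist_eq_norm] using hz
    have : ‖h z‖ = ‖f z‖ := by
      rw [hfg z]
      simp only [h, norm_mul, norm_prod, norm_pow]
      congr 1
      apply Finset.prod_congr rfl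
      intro ρ hρ
      congr 1
      have h1 : (R:ℂ) ^ 2 = (starRingEnd ℂ) (z - c) * (z - c) := by
        rw [mul_comm, Complex.mul_conj, Complex.normSq_eq_norm_sq, hz']; push_cast; ring
      rw [h1, ← sub_mul, ← map_sub, norm_div, norm_mul, hz', RCLike.norm_conj]
      have : ‖(R:ℂ)‖ = R := by rw [Complex.norm_real]; norm_num [R]
      rw [this]
      have hR : R ≠ 0 := by norm_num [R]
      field_simp
      congr 1; ring
    rw [this]
    exact hM z (Metric.sphere_subset_closedBall hz)
  have hc := key c (by norm_num [R])
  refine le_trans ?_ hc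
  rw [hfg c]
  simp only [h, norm_mul, norm_prod, norm_pow]
  rw [← mul_assoc]
  refine mul_le_mul_of_nonneg_right ?_ (norm_nonneg _)
  rw [← Finset.prod_pow_eq_pow_sum, ← Finset.prod_mul_distrib]
  apply Finset.prod_le_prod
  · intros; positivity
  · intro ρ hρ
    rw [← mul_pow]
    apply pow_le_pow_left₀ (by positivity)
    have := hS ρ hρ
    rw [norm_sub_rev] at this
    have h2 : ‖((R:ℂ) ^ 2 - (starRingEnd ℂ) (ρ - c) * (c - c)) / R‖ = R := by
      rw [sub_self, mul_zero, sub_zero]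
      have hR : (R:ℂ) ≠ 0 := by norm_num [R]
      rw [show (R:ℂ)^2 / R = R by field_simp, Complex.norm_real]; norm_num [R]
    rw [h2]
    norm_num [R]; linarith

lemma fz_local {f : ℂ → ℂ} (hf : Differentiable ℂ f) {c : ℂ} {M : ℝ} (h0 : f c ≠ 0)
    (hM : ∀ z ∈ Metric.closedBall c (19 / 10), ‖f z‖ ≤ M) (S : Finset ℂ)
    (hS : ∀ ρ, ρ ∈ S ↔ ρ ∈ Metric.closedBall c (9 / 5) ∧ f ρ = 0) :
    ((∑ ρ ∈ S, analyticOrderNatAt f ρ : ℕ) : ℝ) ≤ 19 * Real.log (M / ‖f c‖) ∧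
    ∀ z ∈ Metric.closedBall c (8 / 5), f z ≠ 0 →
      ‖logDeriv f z - ∑ ρ ∈ S, (analyticOrderNatAt f ρ : ℂ) / (z - ρ)‖ ≤
        200000 * (1 + Real.log (M / ‖f c‖)) := by
  obtain ⟨g, hg, hfg, hgS, hgo⟩ := fz_factor hf h0 S
  have hfc : 0 < ‖f c‖ := norm_pos_iff.2 h0
  have hMc : ‖f c‖ ≤ M := hM c (by norm_num)
  have hMpos : 0 < M := hfc.trans_le hMc
  set m := fun ρ => analyticOrderNatAt f ρ with hm
  set K := ∑ ρ ∈ S, analyticOrderNatAt f ρ with hK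
  set B := Real.log (M / ‖f c‖) with hB
  have hB0 : 0 ≤ B := Real.log_nonneg (by rwa [le_div_iff₀ hfc, one_mul])
  have hSn : ∀ ρ ∈ S, ‖ρ - c‖ ≤ 9 / 5 := fun ρ hρ => by
    simpa [dist_eq_norm] using ((hS ρ).1 hρ).1
  have hcount := fz_count hg S m hfg hSn hM
  have hKB : (K:ℝ) ≤ 19 * B := by
    have h1 : (19/18:ℝ)^K ≤ M / ‖f c‖ := by rwa [le_div_iff₀ hfc]
    have h2 := Real.log_le_log (by positivity) h1
    rw [Real.log_pow] at h2
    have h3 : (1:ℝ)/19 ≤ Real.log (19/18) := by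
      have := Real.one_sub_inv_le_log_of_pos (x := (19/18:ℝ)) (by norm_num)
      norm_num at this ⊢; linarith
    have : (K:ℝ) * (1/19) ≤ B := le_trans (by gcongr) h2
    linarith
  refine ⟨hKB, ?_⟩
  -- bound for g
  have hgb : ∀ z ∈ Metric.closedBall c (19/10), ‖g z‖ ≤ M * 10 ^ K := by
    apply fz_max_mod hg (by norm_num)
    intro z hz
    have hz' : ‖z - c‖ = 19/10 := by simpa [dist_eq_norm] using hz
    have h1 := hM z (Metric.sphere_subset_closedBall hz)
    rw [hfg z, norm_mul, norm_prod] at h1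
    have h2 : (1/10:ℝ)^K ≤ ∏ ρ ∈ S, ‖(z - ρ) ^ (analyticOrderNatAt f ρ)‖ := by
      rw [hK, ← Finset.prod_pow_eq_pow_sum]
      apply Finset.prod_le_prod
      · intros; positivity
      · intro ρ hρ
        rw [norm_pow]
        apply pow_le_pow_left₀ (by norm_num)
        have := norm_sub_norm_le (z - c) (ρ - c)
        rw [sub_sub_sub_cancel_right] at this
        linarith [hSn ρ hρ]
    have h3 : (1/10:ℝ)^K * ‖g z‖ ≤ M :=
      le_trans (mul_le_mul_of_nonneg_right h2 (norm_nonneg _)) h1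
    rw [one_div, inv_pow] at h3
    rw [inv_mul_le_iff₀ (by positivity)] at h3
    linarith
  have hgc : ‖f c‖ ≤ (9/5:ℝ)^K * ‖g c‖ := by
    rw [hfg c, norm_mul, norm_prod]
    apply mul_le_mul_of_nonneg_right _ (norm_nonneg _)
    rw [hK, ← Finset.prod_pow_eq_pow_sum]
    apply Finset.prod_le_prod
    · intros; positivity
    · intro ρ hρ
      rw [norm_pow]
      apply pow_le_pow_left₀ (by positivity)
      rw [norm_sub_rev]; exact hSn ρ hρ
  have hgc0 : g c ≠ 0 := by
    intro h; apply h0; rw [hfg, h, mul_zero]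
  have hgcpos : 0 < ‖g c‖ := norm_pos_iff.2 hgc0
  have hgne : ∀ z ∈ Metric.closedBall c (9/5), g z ≠ 0 := by
    intro z hz h
    by_cases hzS : z ∈ S
    · exact hgS z hzS h
    · apply hzS
      rw [hS]
      exact ⟨hz, by rw [hfg, h, mul_zero]⟩
  -- log of g
  have hgd : DifferentiableOn ℂ (logDeriv g) (Metric.ball c (9/5)) := by
    intro z hz
    have h1 : DifferentiableAt ℂ (deriv g) z := (hg.analyticAt z).deriv.differentiableAt
    have h2 : g z ≠ 0 := hgne z (Metric.ball_subset_closedBall hz)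
    exact (h1.div (hg z) h2).differentiableWithinAt
  obtain ⟨h, hhc, hh⟩ := hgd.isExactOn_ball.with_val_at c 0
  have hexp : ∀ z ∈ Metric.ball c (9/5), g z = g c * Complex.exp (h z) := by
    have hd : ∀ z ∈ Metric.ball c (9/5), HasDerivAt (fun z => g z * Complex.exp (-h z)) 0 z := by
      intro z hz
      have h2 : g z ≠ 0 := hgne z (Metric.ball_subset_closedBall hz)
      have := (hg z).hasDerivAt.mul ((hh z hz).neg.cexp)
      refine HasDerivAt.congr_deriv this ?_
      rw [logDeriv_apply]
      field_simp
      simp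
    intro z hz
    have := (convex_ball c (9/5:ℝ)).is_const_of_fderivWithin_eq_zero (𝕜 := ℂ)
      (f := fun z => g z * Complex.exp (-h z))
      (fun z hz => (hd z hz).differentiableAt.differentiableWithinAt)
      (fun z hz => by
        rw [fderivWithin_of_isOpen Metric.isOpen_ball hz]
        ext
        simpa using (hd z hz).deriv) hz
        (Metric.mem_ball_self (by norm_num))
    simp only [hhc, neg_zero, Complex.exp_zero, mul_one] at this
    rw [← this, mul_assoc, ← Complex.exp_add]; simp
  have hre : ∀ z ∈ Metric.ball c (9/5), (h z).re ≤ 400 * (1 + B) := by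
    intro z hz
    have h1 : ‖g z‖ ≤ M * 10 ^ K :=
      hgb z (Metric.closedBall_subset_closedBall (by norm_num) (Metric.ball_subset_closedBall hz))
    rw [hexp z hz, norm_mul, Complex.norm_exp] at h1
    have h2 : Real.exp (h z).re ≤ (M / ‖f c‖) * 18 ^ K := by
      have e18 : (18:ℝ)^K = (9/5)^K * 10^K := by rw [← mul_pow]; norm_num
      rw [e18, div_mul_eq_mul_div, le_div_iff₀ hfc]
      calc Real.exp (h z).re * ‖f c‖ ≤ Real.exp (h z).re * ((9/5:ℝ)^K * ‖g c‖) := by gcongr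
        _ = (9/5:ℝ)^K * (‖g c‖ * Real.exp (h z).re) := by ring
        _ ≤ (9/5:ℝ)^K * (M * 10 ^ K) := by gcongr
        _ = _ := by ring
    have h3 := Real.log_le_log (Real.exp_pos _) h2
    rw [Real.log_exp, Real.log_mul (by positivity) (by positivity), Real.log_pow] at h3
    have h4 : Real.log 18 ≤ 18 := Real.log_le_self (by norm_num)
    have h5 : (K:ℝ) * Real.log 18 ≤ (19 * B) * 18 :=
      mul_le_mul hKB h4 (Real.log_nonneg (by norm_num)) (by positivity)
    linarith
  intro z hz hfz
  rw [fz_logDeriv_factor hg S m hfg hfz, add_sub_cancel_left]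
  have hz' : ‖z - c‖ ≤ 8/5 := by simpa [dist_eq_norm] using hz
  have hzb : z ∈ Metric.ball c (9/5) := Metric.closedBall_subset_ball (by norm_num) hz
  rw [← (hh z hzb).deriv]
  have hbound : ∀ w ∈ Metric.sphere z (1/10), ‖h w‖ ≤ 2 * (400 * (1 + B)) * (17/10) / (1/10) := by
    intro w hw
    have hw' : ‖w - z‖ = 1/10 := by simpa [dist_eq_norm] using hw
    have hwc : ‖w - c‖ ≤ 17/10 := by
      have := norm_add_le (w - z) (z - c)
      rw [sub_add_sub_cancel] at this
      linarith
    have hshift : ∀ u ∈ Metric.ball (0:ℂ) (9/5), u + c ∈ Metric.ball c (9/5) := by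
      intro u hu; simpa [dist_eq_norm] using hu
    have := Complex.borelCaratheodory_zero (f := fun u => h (u + c)) (M := 400 * (1 + B))
      (R := 9/5) (z := w - c) (by positivity)
      (fun u hu => by
        have := (hh (u + c) (hshift u hu)).differentiableAt
        exact (DifferentiableAt.comp (g := h) u this (by fun_prop)).differentiableWithinAt)
      (fun u hu => hre _ (hshift u hu)) (by norm_num)
      (by simp; linarith) (by simpa using hhc)
    simp only [sub_add_cancel] at this
    refine this.trans ?_
    have : 1/10 ≤ 9/5 - ‖w - c‖ := by linarith
    gcongr
  have := Complex.norm_deriv_le_of_forall_mem_sphere_norm_le (c := z) (R := 1/10) (f := h)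
    (by norm_num) (by
      apply DifferentiableOn.diffContOnCl
      rw [closure_ball _ (by norm_num)]
      intro w hw
      have hw' : ‖w - z‖ ≤ 1/10 := by simpa [dist_eq_norm] using hw
      have hwc : w ∈ Metric.ball c (9/5) := by
        have := norm_add_le (w - z) (z - c)
        rw [sub_add_sub_cancel] at this
        rw [Metric.mem_ball, dist_eq_norm]
        linarith
      exact (hh w hwc).differentiableAt.differentiableWithinAt) hbound
  refine this.trans (le_of_eq_of_le ?_ (mul_le_mul_of_nonneg_right (show (136000:ℝ) ≤ 200000 by norm_num) (by positivity)))
  ring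

noncomputable def fzTerm (n : ℕ) (s : ℂ) : ℂ :=
  (s - 1) * ((n + 1 : ℝ) : ℂ) ^ (-s) - ((n + 1 : ℝ) : ℂ) ^ (1 - s) + ((n + 2 : ℝ) : ℂ) ^ (1 - s)

lemma fz_hasDerivAt_cpow (s : ℂ) {u : ℝ} (hu : 0 < u) :
    HasDerivAt (fun u : ℝ => (u : ℂ) ^ s) (s * (u : ℂ) ^ (s - 1)) u := by
  have h1 : HasDerivAt (fun z : ℂ => z ^ s) (s * (u : ℂ) ^ (s - 1)) (u : ℂ) := by
    have := (hasDerivAt_id (u : ℂ)).cpow_const (c := s) (Or.inl (by simpa using hu))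
    simpa using this
  exact h1.comp_ofReal

lemma fzTerm_bound (n : ℕ) (s : ℂ) (hs : 0 < s.re) :
    ‖fzTerm n s‖ ≤ ‖s - 1‖ * (‖s‖ * (n + 1 : ℝ) ^ (-s.re - 1)) := by
  have hN : (0:ℝ) < n + 1 := by positivity
  have h1 : ∀ u ∈ Set.Icc (n + 1 : ℝ) (n + 2), ‖(u : ℂ) ^ (-s) - ((n + 1 : ℝ) : ℂ) ^ (-s)‖ ≤
      ‖s‖ * (n + 1 : ℝ) ^ (-s.re - 1) := by
    intro u hu
    have := Convex.norm_image_sub_le_of_norm_hasDerivWithin_le (𝕜 := ℝ)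
      (f := fun u : ℝ => (u : ℂ) ^ (-s)) (f' := fun u : ℝ => (-s) * (u : ℂ) ^ (-s - 1))
      (s := Set.Icc (n + 1 : ℝ) (n + 2)) (C := ‖s‖ * (n + 1 : ℝ) ^ (-s.re - 1))
      (x := (n + 1 : ℝ)) (y := u)
      (fun v hv => (fz_hasDerivAt_cpow (-s) (hN.trans_le hv.1)).hasDerivWithinAt)
      (fun v hv => by
        rw [norm_mul, norm_neg, Complex.norm_cpow_eq_rpow_re_of_pos (hN.trans_le hv.1)]
        simp only [sub_re, neg_re, one_re]
        refine mul_le_mul_of_nonneg_left ?_ (norm_nonneg _)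
        exact Real.rpow_le_rpow_of_nonpos hN hv.1 (by linarith))
      (convex_Icc _ _) ⟨le_refl _, by linarith⟩ hu
    refine this.trans ?_
    have : ‖u - (n + 1 : ℝ)‖ ≤ 1 := by
      rw [Real.norm_eq_abs, abs_le]; constructor <;> linarith [hu.1, hu.2]
    exact mul_le_of_le_one_right (by positivity) this
  have h2 := Convex.norm_image_sub_le_of_norm_hasDerivWithin_le (𝕜 := ℝ)
      (f := fun u : ℝ => (s - 1) * ((n + 1 : ℝ) : ℂ) ^ (-s) * u + (u : ℂ) ^ (1 - s))
      (f' := fun u : ℝ => (s - 1) * ((n + 1 : ℝ) : ℂ) ^ (-s) * 1 + (1 - s) * (u : ℂ) ^ (1 - s - 1))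
      (s := Set.Icc (n + 1 : ℝ) (n + 2)) (C := ‖s - 1‖ * (‖s‖ * (n + 1 : ℝ) ^ (-s.re - 1)))
      (x := (n + 1 : ℝ)) (y := n + 2)
      (fun v hv => ((((hasDerivAt_id v).ofReal_comp).const_mul _).add
        (fz_hasDerivAt_cpow (1 - s) (hN.trans_le hv.1))).hasDerivWithinAt)
      (fun v hv => by
        rw [show (s - 1) * ((n + 1 : ℝ) : ℂ) ^ (-s) * 1 + (1 - s) * (v : ℂ) ^ (1 - s - 1)
          = (1 - s) * ((v : ℂ) ^ (-s) - ((n + 1 : ℝ) : ℂ) ^ (-s)) by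
            rw [show 1 - s - 1 = -s by ring]; ring]
        rw [norm_mul, norm_sub_rev 1 s]
        exact mul_le_mul_of_nonneg_left (h1 v hv) (norm_nonneg _))
      (convex_Icc _ _) ⟨le_refl _, by linarith⟩ ⟨by linarith, le_refl _⟩
  have e : ‖((n:ℝ) + 2) - (n + 1 : ℝ)‖ = 1 := by
    rw [show ((n:ℝ) + 2) - (n + 1 : ℝ) = 1 by ring]; simp
  rw [e, mul_one] at h2
  refine le_of_eq_of_le ?_ h2
  congr 1
  unfold fzTerm
  push_cast
  ring

lemma fz_summable_rpow {a : ℝ} (ha : 0 < a) : Summable (fun n : ℕ => (n + 1 : ℝ) ^ (-a - 1)) := by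
  have := (summable_nat_add_iff 1).2 (Real.summable_nat_rpow (p := -a - 1) |>.2 (by linarith))
  simpa using this

lemma fzTerm_bound' {a B : ℝ} (ha : 0 < a) (n : ℕ) (s : ℂ) (hs : a ≤ s.re) (hB : ‖s‖ ≤ B) :
    ‖fzTerm n s‖ ≤ ((B + 1) * B) * (n + 1 : ℝ) ^ (-a - 1) := by
  refine (fzTerm_bound n s (ha.trans_le hs)).trans ?_
  have : ‖s - 1‖ ≤ B + 1 := (norm_sub_le _ _).trans (by simpa using hB)
  have hB0 : 0 ≤ B := (norm_nonneg _).trans hB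
  rw [← mul_assoc]
  have : (n + 1 : ℝ) ^ (-s.re - 1) ≤ (n + 1 : ℝ) ^ (-a - 1) :=
    Real.rpow_le_rpow_of_exponent_le (by linarith [Nat.cast_nonneg (α := ℝ) n]) (by linarith)
  gcongr

lemma fz_zeta1_eq_right {s : ℂ} (hs : 1 < s.re) : riemannZeta₁ s = 1 + ∑' n, fzTerm n s := by
  have hs1 : s ≠ 1 := by rintro rfl; simp at hs
  have h1 : riemannZeta₁ s = (s - 1) * riemannZeta s := by
    rw [riemannZeta_eq_inv_sub_mul hs1, mul_inv_cancel_left₀ (sub_ne_zero.2 hs1)]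
  have hsum : Summable (fun n => fzTerm n s) := by
    refine Summable.of_norm_bounded (((fz_summable_rpow (a := s.re) (by linarith)).mul_left
      ((‖s‖ + 1) * ‖s‖))) (fun n => fzTerm_bound' (by linarith) n s le_rfl le_rfl)
  have hz : HasSum (fun n : ℕ => 1 / ((n:ℂ) + 1) ^ s) (riemannZeta s) := by
    rw [zeta_eq_tsum_one_div_nat_add_one_cpow hs]
    have := (Complex.summable_one_div_nat_cpow (p := s)).2 hs
    have := (summable_nat_add_iff 1).2 this
    simp only [Nat.cast_add, Nat.cast_one] at this
    exact this.hasSum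
  have h2 := hsum.hasSum.tendsto_sum_nat
  have h3 : Tendsto (fun N : ℕ => ∑ n ∈ Finset.range N, fzTerm n s) atTop
      (nhds ((s - 1) * riemannZeta s - 1)) := by
    have h4 : ∀ N : ℕ, ∑ n ∈ Finset.range N, fzTerm n s =
        (s - 1) * (∑ n ∈ Finset.range N, 1 / ((n:ℂ) + 1) ^ s) - 1
          + ((N + 1 : ℝ) : ℂ) ^ (1 - s) := by
      intro N
      induction N with
      | zero => simp
      | succ N ih =>
        rw [Finset.sum_range_succ, ih, Finset.sum_range_succ]
        unfold fzTerm
        rw [Complex.cpow_neg]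
        push_cast
        rw [show (N:ℂ) + 1 + 1 = N + 2 by ring]
        ring
    simp_rw [h4]
    have h5 : Tendsto (fun N : ℕ => ((N + 1 : ℝ) : ℂ) ^ (1 - s)) atTop (nhds 0) := by
      rw [tendsto_zero_iff_norm_tendsto_zero]
      have : ∀ N : ℕ, ‖((N + 1 : ℝ) : ℂ) ^ (1 - s)‖ = (N + 1 : ℝ) ^ (-(s.re - 1)) := by
        intro N
        rw [Complex.norm_cpow_eq_rpow_re_of_pos (by positivity)]
        simp
      simp_rw [this]
      have h6 := tendsto_rpow_neg_atTop (y := s.re - 1) (by linarith)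
      exact h6.comp (tendsto_atTop_add_const_right _ _ tendsto_natCast_atTop_atTop)
    have := ((hz.tendsto_sum_nat.const_mul (s - 1)).sub_const 1).add h5
    simpa using this
  rw [h1, tendsto_nhds_unique h2 h3]
  ring

lemma fz_zeta1_eq {s : ℂ} (hs : 0 < s.re) : riemannZeta₁ s = 1 + ∑' n, fzTerm n s := by
  let V : Set ℂ := {z | s.re / 2 < z.re} ∩ Metric.ball 0 (‖s‖ + 3)
  have hre : s.re ≤ ‖s‖ := Complex.re_le_norm s
  have hVo : IsOpen V := (isOpen_lt continuous_const Complex.continuous_re).inter Metric.isOpen_ball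
  have hVc : Convex ℝ V := (convex_halfSpace_re_gt _).inter (convex_ball _ _)
  have hd : DifferentiableOn ℂ (fun z => ∑' n, fzTerm n z) V := by
    refine differentiableOn_tsum_of_summable_norm (((fz_summable_rpow (a := s.re / 2)
      (by linarith)).mul_left ((‖s‖ + 3 + 1) * (‖s‖ + 3)))) ?_ hVo ?_
    · intro n z hz
      have h1 : ((n + 1 : ℝ) : ℂ) ≠ 0 := by
        exact_mod_cast (by positivity : (n + 1 : ℝ) ≠ 0)
      have h2 : ((n + 2 : ℝ) : ℂ) ≠ 0 := by
        exact_mod_cast (by positivity : (n + 2 : ℝ) ≠ 0)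
      unfold fzTerm
      have d1 : DifferentiableAt ℂ (fun z : ℂ => ((n + 1 : ℝ) : ℂ) ^ (-z)) z :=
        (differentiableAt_id.neg).const_cpow (Or.inl h1)
      have d2 : DifferentiableAt ℂ (fun z : ℂ => ((n + 1 : ℝ) : ℂ) ^ (1 - z)) z :=
        (differentiableAt_id.const_sub 1).const_cpow (Or.inl h1)
      have d3 : DifferentiableAt ℂ (fun z : ℂ => ((n + 2 : ℝ) : ℂ) ^ (1 - z)) z :=
        (differentiableAt_id.const_sub 1).const_cpow (Or.inl h2)
      exact ((((differentiableAt_id.sub_const 1).mul d1).sub d2).add d3).differentiableWithinAt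
    · intro n z hz
      refine fzTerm_bound' (by linarith) n z (le_of_lt hz.1) ?_
      have := hz.2
      simp at this; linarith
  have ha : AnalyticOnNhd ℂ (fun z => 1 + ∑' n, fzTerm n z) V :=
    (hd.const_add 1).analyticOnNhd hVo
  have hb : AnalyticOnNhd ℂ riemannZeta₁ V :=
    fun z _ => differentiable_riemannZeta₁.analyticAt z
  have h0 : ((‖s‖ + 2 : ℝ) : ℂ) ∈ V := by
    refine ⟨?_, ?_⟩
    · simp only [Set.mem_ofPred_eq, ofReal_re]; linarith [norm_nonneg s]
    · rw [mem_ball_zero_iff, Complex.norm_real, Real.norm_eq_abs, abs_of_pos (by positivity)]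
      linarith
  refine hb.eqOn_of_preconnected_of_eventuallyEq ha hVc.isPreconnected h0 ?_ ⟨?_, ?_⟩
  · have : {z : ℂ | 1 < z.re} ∈ nhds ((‖s‖ + 2 : ℝ) : ℂ) :=
      (isOpen_lt continuous_const Complex.continuous_re).mem_nhds (by
        simp only [Set.mem_ofPred_eq, ofReal_re]; linarith [norm_nonneg s])
    filter_upwards [this] with z hz
    exact fz_zeta1_eq_right hz
  · simp only [Set.mem_ofPred_eq]; linarith
  · simp

lemma fz_zeta1_bound : ∃ C : ℝ, 0 < C ∧ ∀ s : ℂ, 1 / 10 ≤ s.re →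
    ‖riemannZeta₁ s‖ ≤ C * (1 + ‖s‖) ^ 2 := by
  have hS := fz_summable_rpow (a := 1 / 10) (by norm_num)
  set Z := ∑' n : ℕ, (n + 1 : ℝ) ^ (-(1 / 10 : ℝ) - 1)
  have hZ : 0 ≤ Z := tsum_nonneg (fun n => by positivity)
  refine ⟨1 + Z, by positivity, fun s hs => ?_⟩
  rw [fz_zeta1_eq (by linarith)]
  have h1 : ‖∑' n, fzTerm n s‖ ≤ ((‖s‖ + 1) * ‖s‖) * Z := by
    rw [← tsum_mul_left]
    exact tsum_of_norm_bounded (hS.mul_left _).hasSum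
      (fun n => fzTerm_bound' (by norm_num) n s hs le_rfl)
  refine (norm_add_le _ _).trans ?_
  rw [norm_one]
  nlinarith [norm_nonneg s, mul_nonneg (norm_nonneg s) hZ]

lemma fz_zeta1_of_ne {s : ℂ} (hs : s ≠ 1) : riemannZeta₁ s = (s - 1) * riemannZeta s := by
  rw [riemannZeta_eq_inv_sub_mul hs, mul_inv_cancel_left₀ (sub_ne_zero.2 hs)]

lemma fz_zeta_two_lower (t : ℝ) : 1 / 3 ≤ ‖riemannZeta (2 + t * I)‖ := by
  have hre : (2 + t * I : ℂ).re = 2 := by simp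
  have hs : 1 < (2 + t * I : ℂ).re := by rw [hre]; norm_num
  set s : ℂ := 2 + t * I
  have hsum : Summable (fun n : ℕ => 1 / ((n:ℂ) + 1) ^ s) := by
    have := (summable_nat_add_iff 1).2 ((Complex.summable_one_div_nat_cpow (p := s)).2 hs)
    simpa only [Nat.cast_add, Nat.cast_one] using this
  have h2 : HasSum (fun n : ℕ => 1 / ((n : ℝ) + 2) ^ 2) (π ^ 2 / 6 - 1) := by
    have := (hasSum_nat_add_iff' 2).2 hasSum_zeta_two
    simpa [Finset.sum_range_succ] using this
  rw [zeta_eq_tsum_one_div_nat_add_one_cpow hs, hsum.tsum_eq_zero_add]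
  have h3 : ‖∑' n : ℕ, 1 / (((n + 1 : ℕ):ℂ) + 1) ^ s‖ ≤ π ^ 2 / 6 - 1 := by
    refine tsum_of_norm_bounded h2 (fun n => ?_)
    rw [norm_div, norm_one]
    have : (((n + 1 : ℕ):ℂ) + 1) = ((n + 2 : ℝ) : ℂ) := by push_cast; ring
    rw [this, Complex.norm_cpow_eq_rpow_re_of_pos (by positivity), hre]
    norm_num
  have hpi : π ^ 2 / 6 - 1 ≤ 2 / 3 := by
    have := Real.pi_lt_d2
    have := Real.pi_pos
    nlinarith
  have h4 : ‖(1:ℂ)‖ ≤ ‖1 / (((0 : ℕ):ℂ) + 1) ^ s + ∑' n : ℕ, 1 / (((n + 1 : ℕ):ℂ) + 1) ^ s‖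
      + ‖∑' n : ℕ, 1 / (((n + 1 : ℕ):ℂ) + 1) ^ s‖ := by
    have e : (1:ℂ) = (1 / (((0 : ℕ):ℂ) + 1) ^ s + ∑' n : ℕ, 1 / (((n + 1 : ℕ):ℂ) + 1) ^ s)
      - ∑' n : ℕ, 1 / (((n + 1 : ℕ):ℂ) + 1) ^ s := by simp
    exact (congrArg norm e).le.trans (norm_sub_le _ _)
  rw [norm_one] at h4
  linarith

lemma fz_zeta1_two_lower (t : ℝ) : 1 / 3 ≤ ‖riemannZeta₁ (2 + t * I)‖ := by
  have hs1 : (2 + t * I : ℂ) ≠ 1 := by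
    intro h; have := congrArg Complex.re h; norm_num at this
  rw [fz_zeta1_of_ne hs1, norm_mul]
  have h1 : 1 ≤ ‖(2 + t * I : ℂ) - 1‖ := by
    have := Complex.re_le_norm ((2 + t * I : ℂ) - 1)
    norm_num at this; linarith
  nlinarith [fz_zeta_two_lower t]

lemma fz_local_zeta : ∃ C : ℝ, 0 < C ∧ ∀ t : ℝ, 2 ≤ |t| → ∃ S : Finset ℂ,
    (∀ ρ, ρ ∈ S ↔ ρ ∈ Metric.closedBall (2 + t * I : ℂ) (9 / 5) ∧ riemannZeta₁ ρ = 0) ∧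
    ((∑ ρ ∈ S, analyticOrderNatAt riemannZeta₁ ρ : ℕ) : ℝ) ≤ C * Real.log |t| ∧
    ∀ z ∈ Metric.closedBall (2 + t * I : ℂ) (8 / 5), riemannZeta₁ z ≠ 0 →
      ‖logDeriv riemannZeta₁ z - ∑ ρ ∈ S, (analyticOrderNatAt riemannZeta₁ ρ : ℂ) / (z - ρ)‖ ≤
        C * Real.log |t| := by
  obtain ⟨C, hC, hb⟩ := fz_zeta1_bound
  set D : ℝ := 1 + |Real.log (48 * C)|
  have hD : 1 ≤ D := by simp [D]
  refine ⟨200000 * (4 * D + 2), by positivity, fun t ht => ?_⟩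
  have ht0 : 0 < |t| := by linarith
  set c : ℂ := 2 + t * I
  have hc0 : riemannZeta₁ c ≠ 0 := by
    intro h; have := fz_zeta1_two_lower t; rw [h] at this; norm_num at this
  have hfin := fz_finite_zeros differentiable_riemannZeta₁ hc0
    (isCompact_closedBall c (9/5 : ℝ))
  have hcn : ‖c‖ ≤ 2 + |t| := by
    refine (norm_add_le _ _).trans ?_
    simp
  have hM : ∀ z ∈ Metric.closedBall c (19 / 10), ‖riemannZeta₁ z‖ ≤ 16 * C * |t| ^ 2 := by
    intro z hz
    have hz' : ‖z - c‖ ≤ 19 / 10 := by simpa [dist_eq_norm] using hz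
    have h1 : 1 / 10 ≤ z.re := by
      have := (abs_le.1 (Complex.abs_re_le_norm (z - c))).1
      have : -(19/10) ≤ z.re - c.re := by
        rw [Complex.sub_re] at this; linarith
      simp [c] at this; linarith
    refine (hb z h1).trans ?_
    have h2 : ‖z‖ ≤ 19/10 + (2 + |t|) := by
      have := norm_add_le (z - c) c
      rw [sub_add_cancel] at this; linarith
    have h3 : 1 + ‖z‖ ≤ 4 * |t| := by linarith
    calc C * (1 + ‖z‖) ^ 2 ≤ C * (4 * |t|) ^ 2 := by gcongr
      _ = _ := by ring
  have key := fz_local differentiable_riemannZeta₁ hc0 hM hfin.toFinset (by simp)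
  have hlog2 : 1 / 2 ≤ Real.log |t| := by
    have h1 := Real.log_le_log (by norm_num) ht
    have := Real.log_two_gt_d9
    linarith
  have hlog : Real.log (16 * C * |t| ^ 2 / ‖riemannZeta₁ c‖) ≤ D + 2 * Real.log |t| := by
    have h1 : 16 * C * |t| ^ 2 / ‖riemannZeta₁ c‖ ≤ (48 * C) * |t| ^ 2 := by
      rw [div_le_iff₀ (norm_pos_iff.2 hc0)]
      have := fz_zeta1_two_lower t
      nlinarith [show 0 < C * |t| ^ 2 by positivity]
    refine (Real.log_le_log (div_pos (by positivity) (norm_pos_iff.2 hc0)) h1).trans ?_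
    rw [Real.log_mul (by positivity) (by positivity), Real.log_pow]
    have := le_abs_self (Real.log (48 * C))
    push_cast
    simp only [D]; linarith
  have h5 : 1 + Real.log (16 * C * |t| ^ 2 / ‖riemannZeta₁ c‖) ≤ (4 * D + 2) * Real.log |t| := by
    nlinarith
  have h6 : 0 ≤ (4 * D + 2) * Real.log |t| := by positivity
  refine ⟨hfin.toFinset, by simp, ?_, fun z hz hz0 => ?_⟩
  · refine key.1.trans ?_
    nlinarith
  · refine (key.2 z hz hz0).trans ?_
    nlinarith

/-- terms of `log Γ(s+1)` -/
noncomputable def fzG (j : ℕ) (s : ℂ) : ℂ :=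
  s * ((Real.log (j+2) - Real.log (j+1) : ℝ) : ℂ) - Complex.log (s + j + 1) + (Real.log (j+1) : ℝ)

/-- terms of `ψ(s+1)` -/
noncomputable def fzG1 (j : ℕ) (s : ℂ) : ℂ :=
  ((Real.log (j+2) - Real.log (j+1) : ℝ) : ℂ) - 1 / (s + j + 1)

/-- `ψ(s+1)` -/
noncomputable def fzD (s : ℂ) : ℂ := ∑' j : ℕ, fzG1 j s

lemma fz_pos_re {s : ℂ} (hs : 0 < s.re) (j : ℕ) : 0 < (s + j + 1).re := by
  have : (0:ℝ) ≤ j := by positivity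
  simp; linarith

lemma fz_ne_re {s : ℂ} (hs : 0 < s.re) (j : ℕ) : (s + j + 1) ≠ 0 := by
  intro h
  have := fz_pos_re hs j
  rw [h] at this; simp at this

lemma fz_norm_re {s : ℂ} (hs : 0 < s.re) (j : ℕ) : (j:ℝ) + 1 ≤ ‖s + j + 1‖ := by
  refine le_trans ?_ (Complex.re_le_norm _)
  simp; linarith

lemma fzG_hasDeriv {s : ℂ} (hs : 0 < s.re) (j : ℕ) : HasDerivAt (fzG j) (fzG1 j s) s := by
  have h1 : HasDerivAt (fun s : ℂ => Complex.log (s + j + 1)) (1/(s+j+1)) s := by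
    have : HasDerivAt (fun s : ℂ => s + j + 1) 1 s := ((hasDerivAt_id s).add_const _).add_const _
    exact this.clog (Or.inl (fz_pos_re hs j))
  have h2 := (((hasDerivAt_id s).mul_const
    ((Real.log (j+2) - Real.log (j+1) : ℝ) : ℂ)).sub h1).add_const ((Real.log (j+1) : ℝ) : ℂ)
  refine HasDerivAt.congr_deriv h2 ?_
  simp [fzG1]

lemma fzG1_hasDeriv {s : ℂ} (hs : 0 < s.re) (j : ℕ) :
    HasDerivAt (fzG1 j) (1/(s+j+1)^2) s := by
  have h0 : HasDerivAt (fun s : ℂ => s + j + 1) 1 s := ((hasDerivAt_id s).add_const _).add_const _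
  have h1 := (h0.inv (fz_ne_re hs j)).const_sub ((Real.log (j+2) - Real.log (j+1) : ℝ) : ℂ)
  have h2 : fzG1 j = fun x : ℂ => ((Real.log (j+2) - Real.log (j+1) : ℝ) : ℂ) - (x + (j:ℂ) + 1)⁻¹ := by
    funext x; simp [fzG1]
  rw [h2]
  refine HasDerivAt.congr_deriv h1 ?_
  simp [neg_div]

lemma fzG1_bound {s : ℂ} (hs : 0 < s.re) (j : ℕ) :
    ‖fzG1 j s‖ ≤ (1 + ‖s‖) * (1 / ((j:ℝ)+1)^2) := by
  have hj : (0:ℝ) < (j:ℝ)+1 := by positivity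
  have hne := fz_ne_re hs j
  have hj' : ((j:ℂ)+1) ≠ 0 := by exact_mod_cast hj.ne'
  have e : fzG1 j s = (((Real.log (j+2) - Real.log (j+1) - 1/((j:ℝ)+1)) : ℝ) : ℂ) + s / ((j+1) * (s+j+1)) := by
    unfold fzG1; push_cast; field_simp; ring
  rw [e]
  have hl : Real.log (j+2) - Real.log (j+1) = Real.log (((j:ℝ)+2)/(j+1)) := by
    rw [Real.log_div (by positivity) (by positivity)]
  have h1 : |Real.log (j+2) - Real.log (j+1) - 1/((j:ℝ)+1)| ≤ 1 / ((j:ℝ)+1)^2 := by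
    rw [hl, abs_le]
    have ha := Real.log_le_sub_one_of_pos (x := ((j:ℝ)+2)/(j+1)) (by positivity)
    have hb := Real.one_sub_inv_le_log_of_pos (x := ((j:ℝ)+2)/(j+1)) (by positivity)
    have ea : ((j:ℝ)+2)/(j+1) - 1 = 1/((j:ℝ)+1) := by field_simp; ring
    have eb : 1 - (((j:ℝ)+2)/(j+1))⁻¹ = 1/((j:ℝ)+2) := by field_simp; ring
    rw [ea] at ha; rw [eb] at hb
    have : 1/((j:ℝ)+1) - 1/((j:ℝ)+2) ≤ 1 / ((j:ℝ)+1)^2 := by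
      rw [div_sub_div _ _ (by positivity) (by positivity), div_le_div_iff₀ (by positivity) (by positivity)]
      nlinarith
    have h0 : 0 ≤ 1 / ((j:ℝ)+1)^2 := by positivity
    constructor <;> linarith
  have h2 : ‖s / (((j:ℂ)+1) * (s+j+1))‖ ≤ ‖s‖ * (1 / ((j:ℝ)+1)^2) := by
    rw [norm_div, norm_mul]
    have : ‖((j:ℂ)+1)‖ = (j:ℝ)+1 := by
      have := Complex.norm_natCast (j+1); push_cast at this; exact this
    rw [this, div_eq_mul_one_div]
    gcongr
    rw [sq]; gcongr; exact fz_norm_re hs j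
  calc _ ≤ _ := norm_add_le _ _
    _ ≤ 1 / ((j:ℝ)+1)^2 + ‖s‖ * (1 / ((j:ℝ)+1)^2) := by
      gcongr
      rw [Complex.norm_real]; exact h1
    _ = _ := by ring

lemma fz_summable_inv_sq : Summable (fun j : ℕ => 1 / ((j:ℝ)+1)^2) := by
  have := (summable_nat_add_iff 1).2 (Real.summable_one_div_nat_pow.2 (by norm_num : 1 < 2))
  simpa using this

/-- half disc -/
def fzHD (R : ℝ) : Set ℂ := {s | 0 < s.re} ∩ Metric.ball 0 R

lemma fzHD_open (R : ℝ) : IsOpen (fzHD R) :=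
  (isOpen_lt continuous_const Complex.continuous_re).inter Metric.isOpen_ball

lemma fzHD_conn (R : ℝ) : IsPreconnected (fzHD R) :=
  ((convex_halfSpace_re_gt 0).inter (convex_ball 0 R)).isPreconnected

lemma fzG_at_one (j : ℕ) : fzG j 1 = 0 := by
  unfold fzG
  have : (1:ℂ) + j + 1 = ((j + 2 : ℝ) : ℂ) := by push_cast; ring
  rw [this, ← Complex.ofReal_log (by positivity)]
  push_cast; ring

lemma fzG1_summable {s : ℂ} (hs : 0 < s.re) : Summable (fun j => fzG1 j s) :=
  Summable.of_norm_bounded (fz_summable_inv_sq.mul_left _) (fzG1_bound hs)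

lemma fzG_main {s : ℂ} (hs : 0 < s.re) :
    Summable (fun j => fzG j s) ∧ HasDerivAt (fun z => ∑' j, fzG j z) (fzD s) s := by
  set R := ‖s‖ + 2
  have hu : Summable (fun j : ℕ => (1 + R) * (1 / ((j:ℝ)+1)^2)) := fz_summable_inv_sq.mul_left _
  have hd : ∀ (n : ℕ), ∀ y ∈ fzHD R, HasDerivAt (fzG n) (fzG1 n y) y := fun n y hy => fzG_hasDeriv hy.1 n
  have hb : ∀ (n : ℕ), ∀ y ∈ fzHD R, ‖fzG1 n y‖ ≤ (1 + R) * (1 / ((n:ℝ)+1)^2) := by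
    intro n y hy
    refine (fzG1_bound hy.1 n).trans ?_
    have : ‖y‖ < R := by simpa using hy.2
    gcongr
  have h1 : (1:ℂ) ∈ fzHD R := ⟨by simp, by simp [R]; linarith [norm_nonneg s]⟩
  have hs' : s ∈ fzHD R := ⟨hs, by simp [R]⟩
  have h0 : Summable (fun n => fzG n 1) := by simp [fzG_at_one]
  exact ⟨summable_of_summable_hasDerivAt_of_isPreconnected hu (fzHD_open R) (fzHD_conn R) hd hb h1 h0 hs',
    hasDerivAt_tsum_of_isPreconnected hu (fzHD_open R) (fzHD_conn R) hd hb h1 h0 hs'⟩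

lemma fzD_deriv {s : ℂ} (hs : 0 < s.re) :
    HasDerivAt fzD (∑' j : ℕ, 1/(s+j+1)^2) s := by
  have hb : ∀ (n : ℕ), ∀ y ∈ {y : ℂ | 0 < y.re}, ‖1/(y+n+1)^2‖ ≤ (1 / ((n:ℝ)+1)^2) := by
    intro n y hy
    rw [norm_div, norm_pow, norm_one]
    gcongr
    exact fz_norm_re hy n
  exact hasDerivAt_tsum_of_isPreconnected fz_summable_inv_sq (isOpen_lt continuous_const Complex.continuous_re)
    (convex_halfSpace_re_gt 0).isPreconnected (fun n y hy => fzG1_hasDeriv hy n) hb hs (fzG1_summable hs) hs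

lemma fz_tele (τ : ℝ) (hτ : 0 < τ) :
    (∑' j : ℕ, 2/((j:ℝ)+1+τ)^2) ≤ 2/τ := by
  refine Real.tsum_le_of_sum_range_le (fun n => by positivity) (fun n => ?_)
  have : ∀ n : ℕ, ∑ j ∈ Finset.range n, 2/((j:ℝ)+1+τ)^2 ≤ 2/τ - 2/((n:ℝ)+τ) := by
    intro n
    induction n with
    | zero => simp
    | succ k ih =>
      rw [Finset.sum_range_succ]
      have : 2/((k:ℝ)+1+τ)^2 ≤ 2/((k:ℝ)+τ) - 2/((k:ℝ)+1+τ) := by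
        rw [div_sub_div _ _ (by positivity) (by positivity), div_le_div_iff₀ (by positivity) (by positivity)]
        have : 0 ≤ (k:ℝ) := by positivity
        nlinarith [mul_pos hτ hτ, mul_nonneg this hτ.le]
      push_cast
      linarith
  have h2 : 0 ≤ 2/((n:ℝ)+τ) := by positivity
  linarith [this n]

lemma fzD1_bound {s : ℂ} (hs : 0 < s.re) (ht : s.im ≠ 0) :
    ‖∑' j : ℕ, 1/(s+j+1)^2‖ ≤ 2/|s.im| := by
  have hτ : 0 < |s.im| := abs_pos.2 ht
  have hsum : Summable (fun j : ℕ => 2/((j:ℝ)+1+|s.im|)^2) := by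
    refine Summable.of_nonneg_of_le (fun j => by positivity) (fun j => ?_) (fz_summable_inv_sq.mul_left 2)
    rw [mul_one_div]
    have : (j:ℝ)+1 ≤ (j:ℝ)+1+|s.im| := le_add_of_nonneg_right hτ.le
    gcongr
  refine le_trans (tsum_of_norm_bounded hsum.hasSum ?_) (fz_tele _ hτ)
  intro j
  rw [norm_div, norm_pow, norm_one]
  have : ((j:ℝ)+1+|s.im|)^2 ≤ 2 * ‖s+j+1‖^2 := by
    rw [Complex.sq_norm, Complex.normSq_apply]
    simp
    have hj : 0 ≤ (j:ℝ) := by positivity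
    nlinarith [sq_nonneg ((j:ℝ)+1-|s.im|), sq_abs s.im]
  have hp : 0 < ‖s+j+1‖ := norm_pos_iff.2 (fz_ne_re hs j)
  rw [div_le_div_iff₀ (by positivity) (by positivity)]
  linarith

lemma fzG_exp {s : ℂ} (hs : 0 < s.re) : Complex.exp (∑' j, fzG j s) = Complex.Gamma (s+1) := by
  have h1 := ((fzG_main hs).1.hasSum.tendsto_sum_nat)
  have h2 := (Complex.continuous_exp.tendsto _).comp h1
  have hs0 : s ≠ 0 := by rintro rfl; simp at hs
  have h3 : ∀ n : ℕ, Complex.exp (∑ j ∈ Finset.range n, fzG j s) =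
      ((n:ℂ)+1)^s * (n.factorial) / ∏ j ∈ Finset.range n, (s + j + 1) := by
    intro n
    induction n with
    | zero => simp
    | succ k ih =>
      rw [Finset.sum_range_succ, Complex.exp_add, ih, Finset.prod_range_succ, Nat.factorial_succ]
      have hk1 : ((k:ℂ)+1) ≠ 0 := by exact_mod_cast (Nat.succ_ne_zero k)
      have hk2 : ((k:ℂ)+2) ≠ 0 := by exact_mod_cast (Nat.succ_ne_zero (k+1))
      have e1 : Complex.exp (fzG k s) = ((k:ℂ)+2)^s / ((k:ℂ)+1)^s * ((k:ℂ)+1) / (s+k+1) := by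
        unfold fzG
        rw [Complex.exp_add, Complex.exp_sub, Complex.exp_log (fz_ne_re hs k), ← Complex.ofReal_exp,
          Real.exp_log (by positivity), Complex.cpow_def_of_ne_zero hk1, Complex.cpow_def_of_ne_zero hk2,
          ← Complex.exp_sub]
        have a1 : Complex.log ((k:ℂ)+1) = (Real.log (k+1) : ℝ) := by
          rw [Complex.ofReal_log (by positivity)]; push_cast; rfl
        have a2 : Complex.log ((k:ℂ)+2) = (Real.log (k+2) : ℝ) := by
          rw [Complex.ofReal_log (by positivity)]; push_cast; rfl
        rw [a1, a2]
        push_cast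
        rw [show (Real.log (k+2) : ℂ) * s - Real.log (k+1) * s = s * (Real.log (k+2) - Real.log (k+1)) by ring]
        ring
      rw [e1]
      have hc : ((k:ℂ)+1)^s ≠ 0 := by rw [Complex.cpow_def_of_ne_zero hk1]; exact Complex.exp_ne_zero _
      push_cast
      rw [show ((k:ℂ)+1+1) = (k:ℂ)+2 by ring]
      field_simp
  have h4 : Tendsto (fun n : ℕ => (s+1).GammaSeq n) atTop (nhds (Complex.Gamma (s+1))) :=
    Complex.GammaSeq_tendsto_Gamma _
  -- relate
  have h5 : ∀ n : ℕ, 0 < n → Complex.exp (∑ j ∈ Finset.range (n+1), fzG j s) =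
      (s+1).GammaSeq n * ((((n:ℂ)+2)/n)^s * (((n:ℂ)+1)/n)) := by
    intro n hn
    have hn0 : (n:ℂ) ≠ 0 := by exact_mod_cast hn.ne'
    rw [h3, Complex.GammaSeq, Nat.factorial_succ]
    have e1 : (((n:ℂ)+2)/n)^s = ((n:ℂ)+2)^s / (n:ℂ)^s := by
      have := Complex.div_cpow_ofReal_nonneg (a := (n:ℝ)+2) (b := n) (by positivity) (by positivity) s
      push_cast at this; exact this
    have e2 : ∏ j ∈ Finset.range (n+1), (s+1+(j:ℂ)) = ∏ j ∈ Finset.range (n+1), (s+j+1) :=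
      Finset.prod_congr rfl (fun j _ => by ring)
    have e3 : (n:ℂ)^(s+1) = (n:ℂ)^s * n := by rw [Complex.cpow_add _ _ hn0, Complex.cpow_one]
    have hP : ∏ j ∈ Finset.range (n+1), (s+(j:ℂ)+1) ≠ 0 := Finset.prod_ne_zero_iff.2 (fun j _ => fz_ne_re hs j)
    have hc : (n:ℂ)^s ≠ 0 := by rw [Complex.cpow_def_of_ne_zero hn0]; exact Complex.exp_ne_zero _
    rw [e1, e2, e3]
    push_cast
    rw [show ((n:ℂ)+1+1) = (n:ℂ)+2 by ring]
    field_simp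
  have h6 : Tendsto (fun n : ℕ => (((n:ℂ)+2)/n)^s * (((n:ℂ)+1)/n)) atTop (nhds 1) := by
    have a : ∀ c : ℂ, Tendsto (fun n : ℕ => ((n:ℂ)+c)/n) atTop (nhds 1) := by
      intro c
      have : Tendsto (fun n : ℕ => 1 + c * (1/(n:ℂ))) atTop (nhds (1 + c * 0)) := by
        refine tendsto_const_nhds.add (tendsto_const_nhds.mul ?_)
        exact tendsto_one_div_atTop_nhds_zero_nat
      simp only [mul_zero, add_zero] at this
      refine this.congr' ?_
      filter_upwards [eventually_gt_atTop 0] with n hn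
      have hn0 : (n:ℂ) ≠ 0 := by exact_mod_cast hn.ne'
      field_simp
    have b : Tendsto (fun n : ℕ => (((n:ℂ)+2)/n)^s) atTop (nhds ((1:ℂ)^s)) := by
      refine ((continuousAt_cpow_const (a := (1:ℂ)) (b := s) ?_).tendsto).comp (a 2)
      simp
    simpa using b.mul (a 1)
  have h7 := h4.mul h6
  have h8 := h2.comp (tendsto_add_atTop_nat 1)
  rw [mul_one] at h7
  refine tendsto_nhds_unique h8 (h7.congr' ?_)
  filter_upwards [eventually_gt_atTop 0] with n hn
  exact (h5 n hn).symm

lemma fz_Gamma_deriv {s : ℂ} (hs : 0 < s.re) :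
    HasDerivAt (fun z => Complex.Gamma (z+1)) (Complex.Gamma (s+1) * fzD s) s := by
  have h := (fzG_main hs).2.cexp
  rw [fzG_exp hs] at h
  refine h.congr_of_eventuallyEq ?_
  filter_upwards [(isOpen_lt continuous_const Complex.continuous_re).mem_nhds hs] with z hz
  exact (fzG_exp hz).symm

lemma fzD_growth : ∃ C > 0, ∀ s : ℂ, 0 < s.re → s.re ≤ 1 → 1 ≤ |s.im| → ‖fzD s‖ ≤ C + 2 * Real.log |s.im| := by
  set K := ∑' j : ℕ, 1 / ((j:ℝ)+1)^2
  have hK : 0 ≤ K := tsum_nonneg (fun j => by positivity)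
  refine ⟨3 * K + 1, by positivity, fun s hs hs1 ht => ?_⟩
  obtain ⟨ε, hε, he⟩ : ∃ ε : ℝ, |ε| = 1 ∧ s.im = ε * |s.im| := by
    rcases le_total 0 s.im with h | h
    · exact ⟨1, by simp, by rw [abs_of_nonneg h]; simp⟩
    · exact ⟨-1, by simp, by rw [abs_of_nonpos h]; simp⟩
  let p : ℝ → ℂ := fun v => s.re + (ε * Real.exp v : ℝ) * I
  have hpre : ∀ v, (p v).re = s.re := fun v => by simp [p, Complex.exp_ofReal_im]
  have hpim : ∀ v, (p v).im = ε * Real.exp v := fun v => by simp [p, ← Complex.ofReal_exp]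
  have hpimabs : ∀ v, |(p v).im| = Real.exp v := fun v => by rw [hpim, abs_mul, hε, one_mul, abs_of_pos (Real.exp_pos v)]
  have hpd : ∀ v, HasDerivAt p ((ε * Real.exp v : ℝ) * I) v := by
    intro v
    have := (((Real.hasDerivAt_exp v).const_mul ε).ofReal_comp.mul_const I).const_add (s.re : ℂ)
    exact this
  have hfd : ∀ v, HasDerivAt (fun v => fzD (p v))
      ((∑' j : ℕ, 1/(p v+j+1)^2) * ((ε * Real.exp v : ℝ) * I)) v := by
    intro v
    exact (fzD_deriv (s := p v) (by rw [hpre]; exact hs)).comp v (hpd v)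
  have hb : ∀ v, ‖(∑' j : ℕ, 1/(p v+j+1)^2) * ((ε * Real.exp v : ℝ) * I)‖ ≤ 2 := by
    intro v
    rw [norm_mul]
    have h1 := fzD1_bound (s := p v) (by rw [hpre]; exact hs) (by
      rw [← abs_pos, hpimabs]; exact Real.exp_pos v)
    rw [hpimabs] at h1
    have h2 : ‖((ε * Real.exp v : ℝ) : ℂ) * I‖ = Real.exp v := by
      rw [norm_mul, Complex.norm_I, mul_one, Complex.norm_real, Real.norm_eq_abs, abs_mul, hε, one_mul,
        abs_of_pos (Real.exp_pos v)]
    rw [h2]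
    calc _ ≤ 2 / Real.exp v * Real.exp v := by gcongr
      _ = 2 := by field_simp
  have hmv := Convex.norm_image_sub_le_of_norm_hasDerivWithin_le (s := Set.univ) (C := 2)
    (fun v _ => (hfd v).hasDerivWithinAt) (fun v _ => hb v) convex_univ (mem_univ (0:ℝ)) (mem_univ (Real.log |s.im|))
  have hps : p (Real.log |s.im|) = s := by
    apply Complex.ext
    · exact hpre _
    · rw [hpim, Real.exp_log (by linarith), ← he]
  simp only [hps, sub_zero, Real.norm_eq_abs, abs_of_nonneg (Real.log_nonneg ht)] at hmv
  have h0 : ‖fzD (p 0)‖ ≤ 3 * K := by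
    refine tsum_of_norm_bounded (fz_summable_inv_sq.hasSum.mul_left 3) (fun j => ?_)
    refine (fzG1_bound (by rw [hpre]; exact hs) j).trans ?_
    have : ‖p 0‖ ≤ 2 := by
      refine (Complex.norm_le_abs_re_add_abs_im _).trans ?_
      rw [hpimabs, hpre, abs_of_pos hs]; simp; linarith
    gcongr; linarith
  have := norm_sub_norm_le (fzD s) (fzD (p 0))
  linarith

/-- the Riemann xi function -/
noncomputable def fzXi (s : ℂ) : ℂ := s * (s - 1) * completedRiemannZeta₀ s + 1

/-- archimedean factor -/
noncomputable def fzB (s : ℂ) : ℂ := 2 * (π:ℂ)^(-s/2) * Complex.Gamma (s/2+1)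

/-- its logarithmic derivative -/
noncomputable def fzA (s : ℂ) : ℂ := -(Real.log π : ℂ)/2 + fzD (s/2)/2

lemma fzXi_diff : Differentiable ℂ fzXi := by
  unfold fzXi
  have := differentiable_completedZeta₀
  fun_prop

lemma fzXi_symm (s : ℂ) : fzXi (1 - s) = fzXi s := by
  unfold fzXi; rw [completedRiemannZeta₀_one_sub]; ring

lemma fzXi_one : fzXi 1 = 1 := by simp [fzXi]

lemma fz_re_half {s : ℂ} (hs : 0 < s.re) : 0 < (s/2).re := by
  have : (s/2).re = s.re/2 := by simp
  rw [this]; linarith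

lemma fzB_ne {s : ℂ} (hs : 0 < s.re) : fzB s ≠ 0 := by
  have h := fz_re_half hs
  have hπ : (π:ℂ) ≠ 0 := by exact_mod_cast Real.pi_ne_zero
  unfold fzB
  refine mul_ne_zero (mul_ne_zero two_ne_zero ?_) ?_
  · rw [Complex.cpow_def_of_ne_zero hπ]; exact Complex.exp_ne_zero _
  · apply Complex.Gamma_ne_zero_of_re_pos
    rw [Complex.add_re, Complex.one_re]; linarith

lemma fzXi_eq {s : ℂ} (hs : 0 < s.re) : fzXi s = fzB s * riemannZeta₁ s := by
  have hs0 : s ≠ 0 := by rintro rfl; simp at hs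
  have hB : fzB s = s * Gammaℝ s := by
    unfold fzB Gammaℝ
    rw [Complex.Gamma_add_one _ (by simpa using hs0)]; ring
  by_cases h1 : s = 1
  · subst h1; rw [fzXi_one, hB, riemannZeta₁_one]; simp [Gammaℝ_one]
  · have hG : Gammaℝ s ≠ 0 := Gammaℝ_ne_zero_of_re_pos hs
    rw [hB, fz_zeta1_of_ne h1, riemannZeta_def_of_ne_zero hs0, completedRiemannZeta_eq]
    unfold fzXi
    have : (1 - s) ≠ 0 := sub_ne_zero.2 (Ne.symm h1)
    field_simp
    ring

lemma fzB_hasDeriv {s : ℂ} (hs : 0 < s.re) : HasDerivAt fzB (fzB s * fzA s) s := by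
  have hπ : (π:ℂ) ≠ 0 := by exact_mod_cast Real.pi_ne_zero
  have h1 : HasDerivAt (fun z : ℂ => -z/2) (-1/2) s := ((hasDerivAt_id s).neg).div_const 2
  have h2 := h1.const_cpow (c := (π:ℂ)) (Or.inl hπ)
  have h3 : HasDerivAt (fun z : ℂ => z/2) (1/2) s := (hasDerivAt_id s).div_const 2
  have h4 := (fz_Gamma_deriv (fz_re_half hs)).comp s h3
  have h5 := (h2.const_mul 2).mul h4
  have h6 : HasDerivAt fzB _ s := h5
  refine h6.congr_deriv ?_
  unfold fzB fzA
  rw [← Complex.ofReal_log Real.pi_pos.le]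
  simp only [Function.comp]
  ring

/-- derivative of fzA -/
noncomputable def fzA1 (s : ℂ) : ℂ := (∑' j : ℕ, 1/(s/2+j+1)^2) / 4

lemma fzA_hasDeriv {s : ℂ} (hs : 0 < s.re) : HasDerivAt fzA (fzA1 s) s := by
  have h3 : HasDerivAt (fun z : ℂ => z/2) (1/2) s := (hasDerivAt_id s).div_const 2
  have h4 := (((fzD_deriv (fz_re_half hs)).comp s h3).div_const 2).const_add (-(Real.log π : ℂ)/2)
  have h6 : HasDerivAt fzA _ s := h4
  refine h6.congr_deriv ?_
  unfold fzA1; ring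

lemma fzA1_bound {s : ℂ} (hs : 0 < s.re) (ht : s.im ≠ 0) : ‖fzA1 s‖ ≤ 1/|s.im| := by
  have him : (s/2).im = s.im/2 := by simp
  have h := fzD1_bound (fz_re_half hs) (by rw [him]; simpa using ht)
  unfold fzA1
  rw [him, abs_div, abs_two] at h
  have hp : 0 < |s.im| := abs_pos.2 ht
  rw [norm_div]
  simp only [Complex.norm_ofNat]
  calc _ ≤ 2/(|s.im|/2)/4 := by gcongr
    _ = _ := by field_simp; norm_num

lemma fzA_bound : ∃ C > 0, ∀ s : ℂ, 0 < s.re → s.re ≤ 2 → 2 ≤ |s.im| → ‖fzA s‖ ≤ C * Real.log |s.im| := by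
  obtain ⟨C, hC, h⟩ := fzD_growth
  refine ⟨|Real.log π| + C + 2, by positivity, fun s hs hs2 ht => ?_⟩
  have him : (s/2).im = s.im/2 := by simp
  have hre : (s/2).re = s.re/2 := by simp
  have h1 := h (s/2) (fz_re_half hs) (by rw [hre]; linarith) (by rw [him, abs_div, abs_two]; linarith)
  have hl2 : 1/2 ≤ Real.log |s.im| := by
    have := Real.log_le_log (by norm_num) ht
    have := Real.log_two_gt_d9
    linarith
  have hl3 : Real.log |(s/2).im| ≤ Real.log |s.im| := by
    rw [him, abs_div, abs_two]
    apply Real.log_le_log (by linarith) (by linarith)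
  unfold fzA
  calc _ ≤ ‖-(Real.log π : ℂ)/2‖ + ‖fzD (s/2)/2‖ := norm_add_le _ _
    _ = |Real.log π|/2 + ‖fzD (s/2)‖/2 := by
      rw [norm_div, norm_neg, norm_div, Complex.norm_real, Complex.norm_ofNat, Real.norm_eq_abs]
    _ ≤ |Real.log π|/2 + (C + 2 * Real.log |s.im|)/2 := by gcongr; linarith
    _ ≤ _ := by nlinarith [abs_nonneg (Real.log π)]

lemma fz_zeta1_ne {s : ℂ} (hs : 1 ≤ s.re) : riemannZeta₁ s ≠ 0 := by
  by_cases h1 : s = 1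
  · subst h1; rw [riemannZeta₁_one]; exact one_ne_zero
  · rw [fz_zeta1_of_ne h1]
    exact mul_ne_zero (sub_ne_zero.2 h1) (riemannZeta_ne_zero_of_one_le_re hs)

lemma fzXi_ne_right {s : ℂ} (hs : 1 ≤ s.re) : fzXi s ≠ 0 := by
  rw [fzXi_eq (by linarith)]
  exact mul_ne_zero (fzB_ne (by linarith)) (fz_zeta1_ne hs)

lemma fzXi_zero_re {s : ℂ} (h : fzXi s = 0) : 0 < s.re ∧ s.re < 1 := by
  constructor
  · by_contra h'
    push Not at h'
    apply fzXi_ne_right (s := 1 - s) (by simp; linarith)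
    rw [fzXi_symm, h]
  · by_contra h'
    push Not at h'
    exact fzXi_ne_right h' h

lemma fzXi_zero_iff1 {s : ℂ} (hs : 0 < s.re) : fzXi s = 0 ↔ riemannZeta₁ s = 0 := by
  rw [fzXi_eq hs]; simp [fzB_ne hs]

lemma fzXi_zero_iff {s : ℂ} : fzXi s = 0 ↔ riemannZeta s = 0 ∧ 0 < s.re ∧ s.re < 1 := by
  constructor
  · intro h
    have h2 := fzXi_zero_re h
    rw [fzXi_zero_iff1 h2.1, fz_zeta1_of_ne (by rintro rfl; simp at h2)] at h
    refine ⟨?_, h2⟩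
    rcases mul_eq_zero.1 h with h | h
    · rw [sub_eq_zero] at h; rw [h] at h2; simp at h2
    · exact h
  · rintro ⟨h, h1, h2⟩
    rw [fzXi_zero_iff1 h1, fz_zeta1_of_ne (by rintro rfl; simp at h2), h, mul_zero]

lemma fz_order_mul_ne {f g h : ℂ → ℂ} {z : ℂ} (hg : AnalyticAt ℂ g z) (hh : AnalyticAt ℂ h z)
    (hg0 : g z ≠ 0) (e : f =ᶠ[nhds z] fun w => g w * h w) : analyticOrderAt f z = analyticOrderAt h z := by
  rw [analyticOrderAt_congr e]
  have : (fun w => g w * h w) = g * h := rfl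
  rw [this, analyticOrderAt_mul hg hh, hg.analyticOrderAt_eq_zero.2 hg0, zero_add]

lemma fzXi_order {s : ℂ} (hs : 0 < s.re) : analyticOrderAt fzXi s = analyticOrderAt riemannZeta₁ s := by
  have hn : {z : ℂ | 0 < z.re} ∈ nhds s := (isOpen_lt continuous_const Complex.continuous_re).mem_nhds hs
  apply fz_order_mul_ne (g := fzB)
  · rw [Complex.analyticAt_iff_eventually_differentiableAt]
    filter_upwards [hn] with z hz
    exact (fzB_hasDeriv hz).differentiableAt
  · exact differentiable_riemannZeta₁.analyticAt s
  · exact fzB_ne hs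
  · filter_upwards [hn] with z hz
    exact fzXi_eq hz

lemma fz_zeta_analytic {s : ℂ} (hs : s ≠ 1) : AnalyticAt ℂ riemannZeta s := by
  rw [Complex.analyticAt_iff_eventually_differentiableAt]
  filter_upwards [isOpen_ne.mem_nhds hs] with z hz
  exact differentiableAt_riemannZeta hz

lemma fzXi_mult {s : ℂ} (hs : 0 < s.re) (hs1 : s.re < 1) : zetaZeroMult s = analyticOrderNatAt fzXi s := by
  have h1 : s ≠ 1 := by rintro rfl; simp at hs1
  unfold zetaZeroMult
  rw [dif_pos (fz_zeta_analytic h1)]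
  unfold analyticOrderNatAt
  rw [fzXi_order hs]
  congr 1
  symm
  apply fz_order_mul_ne (g := fun z => z - 1)
  · fun_prop
  · exact fz_zeta_analytic h1
  · exact sub_ne_zero.2 h1
  · filter_upwards [isOpen_ne.mem_nhds h1] with z hz
    exact fz_zeta1_of_ne hz

lemma fzXi_mult' {s : ℂ} (hs : 0 < s.re) : analyticOrderNatAt riemannZeta₁ s = analyticOrderNatAt fzXi s := by
  unfold analyticOrderNatAt
  rw [fzXi_order hs]

lemma fzXi_order_symm (s : ℂ) : analyticOrderAt fzXi (1 - s) = analyticOrderAt fzXi s := by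
  have h := analyticOrderAt_comp_of_deriv_ne_zero (f := fzXi) (g := fun z : ℂ => 1 - z) (z₀ := s)
    (by fun_prop) (by simp [deriv_const_sub])
  rw [← h]
  congr 1
  funext z
  exact (fzXi_symm z).symm ▸ rfl

lemma fzXi_logDeriv {s : ℂ} (hs : 0 < s.re) (h0 : riemannZeta₁ s ≠ 0) :
    logDeriv fzXi s = fzA s + logDeriv riemannZeta₁ s := by
  have hn : {z : ℂ | 0 < z.re} ∈ nhds s := (isOpen_lt continuous_const Complex.continuous_re).mem_nhds hs
  have e : fzXi =ᶠ[nhds s] fun w => fzB w * riemannZeta₁ w := by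
    filter_upwards [hn] with z hz using fzXi_eq hz
  have h1 : logDeriv fzXi s = logDeriv (fun w => fzB w * riemannZeta₁ w) s := by
    rw [logDeriv_apply, logDeriv_apply, e.deriv_eq, e.eq_of_nhds]
  rw [h1, logDeriv_mul s (fzB_ne hs) h0 (fzB_hasDeriv hs).differentiableAt (differentiable_riemannZeta₁ s)]
  congr 1
  rw [logDeriv_apply, (fzB_hasDeriv hs).deriv]
  have := fzB_ne hs
  field_simp

lemma fzXi_logDeriv_symm (s : ℂ) : logDeriv fzXi (1 - s) = - logDeriv fzXi s := by
  have h : deriv fzXi s = - deriv fzXi (1 - s) := by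
    have h1 : HasDerivAt (fun z : ℂ => 1 - z) (-1) s := by
      simpa using (hasDerivAt_id s).const_sub 1
    have h2 := (fzXi_diff (1 - s)).hasDerivAt.comp s h1
    have h3 : (fzXi ∘ fun z : ℂ => 1 - z) = fzXi := by funext z; exact fzXi_symm z
    rw [h3] at h2
    rw [h2.deriv]; ring
  rw [logDeriv_apply, logDeriv_apply, h, fzXi_symm]; ring

/-- multiplicity -/
noncomputable def fzm (ρ : ℂ) : ℕ := analyticOrderNatAt fzXi ρ

lemma fzXi_ne_one : fzXi 1 ≠ 0 := by rw [fzXi_one]; exact one_ne_zero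

lemma fzm_pos {ρ : ℂ} (h : fzXi ρ = 0) : 1 ≤ fzm ρ := by
  have h1 := fz_order_ne_top fzXi_diff fzXi_ne_one ρ
  have h2 : analyticOrderAt fzXi ρ ≠ 0 := by
    rw [Ne, (fzXi_diff.analyticAt ρ).analyticOrderAt_eq_zero]; simpa using h
  unfold fzm analyticOrderNatAt
  rw [Nat.one_le_iff_ne_zero]
  intro h3
  rw [ENat.toNat_eq_zero] at h3
  tauto

lemma fzm_symm (ρ : ℂ) : fzm (1 - ρ) = fzm ρ := by
  unfold fzm analyticOrderNatAt; rw [fzXi_order_symm]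

lemma fzZ_finite (a b : ℝ) : {ρ : ℂ | fzXi ρ = 0 ∧ a ≤ ρ.im ∧ ρ.im ≤ b}.Finite := by
  have hK : IsCompact (Icc (0:ℝ) 1 ×ℂ Icc a b) := isCompact_Icc.reProdIm isCompact_Icc
  refine (fz_finite_zeros fzXi_diff fzXi_ne_one hK).subset ?_
  rintro ρ ⟨h0, h1, h2⟩
  have := fzXi_zero_re h0
  refine ⟨?_, h0⟩
  rw [Complex.mem_reProdIm]
  exact ⟨⟨this.1.le, this.2.le⟩, h1, h2⟩

/-- zeros of xi with imaginary part in `[a,b]` -/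
noncomputable def fzZ (a b : ℝ) : Finset ℂ := (fzZ_finite a b).toFinset

lemma mem_fzZ {a b : ℝ} {ρ : ℂ} : ρ ∈ fzZ a b ↔ fzXi ρ = 0 ∧ a ≤ ρ.im ∧ ρ.im ≤ b := by
  unfold fzZ; rw [Set.Finite.mem_toFinset]; rfl

lemma fz_gap (H : Finset ℝ) (T : ℝ) :
    ∃ T' ∈ Icc T (T+1), ∀ h ∈ H, 1/(2*((H.card:ℝ)+1)) ≤ |T' - h| := by
  by_contra hcon
  push Not at hcon
  set N := H.card + 1 with hN
  have hNp : (0:ℝ) < (H.card:ℝ)+1 := by positivity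
  have hex : ∀ i : Fin N, ∃ h ∈ H, |T + (2*(i:ℝ)+1)/(2*((H.card:ℝ)+1)) - h| < 1/(2*((H.card:ℝ)+1)) := by
    intro i
    apply hcon
    have hi : (i:ℝ) + 1 ≤ (H.card:ℝ)+1 := by
      have : (i:ℕ) + 1 ≤ H.card + 1 := i.2
      exact_mod_cast this
    have hi0 : (0:ℝ) ≤ i := by positivity
    constructor
    · have : 0 ≤ (2*(i:ℝ)+1)/(2*((H.card:ℝ)+1)) := by positivity
      linarith
    · have : (2*(i:ℝ)+1)/(2*((H.card:ℝ)+1)) ≤ 1 := by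
        rw [div_le_one (by positivity)]; linarith
      linarith
  choose f hf hfd using hex
  have hinj : Function.Injective f := by
    intro i j hij
    by_contra hne
    have h1 := hfd i
    have h2 := hfd j
    rw [← hij] at h2
    have h3 : |(2*(i:ℝ)+1)/(2*((H.card:ℝ)+1)) - (2*(j:ℝ)+1)/(2*((H.card:ℝ)+1))| < 2 * (1/(2*((H.card:ℝ)+1))) := by
      rw [abs_lt] at *; constructor <;> linarith
    have h4 : (2*(i:ℝ)+1)/(2*((H.card:ℝ)+1)) - (2*(j:ℝ)+1)/(2*((H.card:ℝ)+1)) = ((i:ℝ)-j)/((H.card:ℝ)+1) := by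
      field_simp; ring
    rw [h4, abs_div, abs_of_pos hNp, show 2 * (1/(2*((H.card:ℝ)+1))) = 1/((H.card:ℝ)+1) by field_simp,
      div_lt_div_iff_of_pos_right hNp] at h3
    have h5 : |((i:ℕ):ℤ) - ((j:ℕ):ℤ)| < 1 := by exact_mod_cast h3
    rw [Int.abs_lt_one_iff] at h5
    apply hne; ext; omega
  have := Finset.card_le_card_of_injOn (s := Finset.univ) (t := H) f (fun i _ => hf i) hinj.injOn
  simp [hN] at this

lemma fz_dist {t : ℝ} {z : ℂ} (h1 : 1/2 ≤ z.re) (h2 : z.re ≤ 2) (h3 : |z.im - t| ≤ 1/2) :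
    z ∈ Metric.closedBall (2 + t * I : ℂ) (8/5) := by
  rw [Metric.mem_closedBall, dist_eq_norm]
  refine (sq_le_sq₀ (norm_nonneg _) (by norm_num)).1 ?_
  rw [Complex.sq_norm, Complex.normSq_apply]
  simp
  have := sq_abs (z.im - t)
  have h4 : (z.im - t)^2 ≤ 1/4 := by rw [← this]; nlinarith [abs_nonneg (z.im - t)]
  nlinarith

lemma fz_dist' {t : ℝ} {z : ℂ} (h : z ∈ Metric.closedBall (2 + t * I : ℂ) (9/5)) : 0 < z.re := by
  rw [Metric.mem_closedBall, dist_eq_norm] at h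
  have := (Complex.abs_re_le_norm _).trans h
  simp at this
  rw [abs_le] at this; linarith

lemma fz_count_strip : ∃ C > 0, ∀ T : ℝ, 3 ≤ T →
    (∑ ρ ∈ fzZ T (T+1), (fzm ρ : ℝ)) ≤ C * Real.log T := by
  obtain ⟨C, hC, hloc⟩ := fz_local_zeta
  refine ⟨4 * C, by positivity, fun T hT => ?_⟩
  set t := T + 1/2 with ht
  have htp : |t| = t := abs_of_pos (by linarith)
  obtain ⟨S, hS, hSc, -⟩ := hloc t (by rw [htp]; linarith)
  obtain ⟨S', hS', hSc', -⟩ := hloc (-t) (by rw [abs_neg, htp]; linarith)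
  rw [abs_neg] at hSc'
  rw [htp] at hSc hSc'
  have hlog : Real.log t ≤ 2 * Real.log T := by
    have : 2 * Real.log T = Real.log (T^2) := by rw [Real.log_pow]; norm_num
    rw [this]; apply Real.log_le_log (by linarith); nlinarith
  have hm : ∑ ρ ∈ S, (fzm ρ : ℝ) ≤ C * Real.log t := by
    refine le_trans (le_of_eq ?_) hSc
    push_cast
    exact Finset.sum_congr rfl (fun ρ hρ => by rw [fzXi_mult' (fz_dist' ((hS ρ).1 hρ).1)]; rfl)
  have hm' : ∑ ρ ∈ S', (fzm ρ : ℝ) ≤ C * Real.log t := by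
    refine le_trans (le_of_eq ?_) hSc'
    push_cast
    exact Finset.sum_congr rfl (fun ρ hρ => by rw [fzXi_mult' (fz_dist' ((hS' ρ).1 hρ).1)]; rfl)
  rw [← Finset.sum_filter_add_sum_filter_not _ (fun ρ : ℂ => 1/2 ≤ ρ.re)]
  have h1 : ∑ ρ ∈ (fzZ T (T+1)).filter (fun ρ : ℂ => 1/2 ≤ ρ.re), (fzm ρ : ℝ) ≤ ∑ ρ ∈ S, (fzm ρ : ℝ) := by
    apply Finset.sum_le_sum_of_subset_of_nonneg
    · intro ρ hρ
      rw [Finset.mem_filter, mem_fzZ] at hρ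
      obtain ⟨⟨h0, h1, h2⟩, h3⟩ := hρ
      have hre := fzXi_zero_re h0
      rw [hS]
      refine ⟨Metric.closedBall_subset_closedBall (by norm_num) (fz_dist h3 (by linarith) ?_), (fzXi_zero_iff1 hre.1).1 h0⟩
      rw [abs_le]; constructor <;> linarith
    · intros; positivity
  have h2 : ∑ ρ ∈ (fzZ T (T+1)).filter (fun ρ : ℂ => ¬ 1/2 ≤ ρ.re), (fzm ρ : ℝ) ≤ ∑ ρ ∈ S', (fzm ρ : ℝ) := by
    have : ∑ ρ ∈ (fzZ T (T+1)).filter (fun ρ : ℂ => ¬ 1/2 ≤ ρ.re), (fzm ρ : ℝ) =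
      ∑ ρ ∈ ((fzZ T (T+1)).filter (fun ρ : ℂ => ¬ 1/2 ≤ ρ.re)).image (fun ρ => 1 - ρ), (fzm ρ : ℝ) := by
      rw [Finset.sum_image (fun a _ b _ h => by simpa using h)]
      exact Finset.sum_congr rfl (fun ρ _ => by rw [fzm_symm])
    rw [this]
    apply Finset.sum_le_sum_of_subset_of_nonneg
    · intro ρ' hρ'
      rw [Finset.mem_image] at hρ'
      obtain ⟨ρ, hρ, rfl⟩ := hρ'
      rw [Finset.mem_filter, mem_fzZ] at hρ
      obtain ⟨⟨h0, h1, h2⟩, h3⟩ := hρ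
      have hre := fzXi_zero_re h0
      have hre1 : (1 - ρ).re = 1 - ρ.re := by simp
      have him1 : (1 - ρ).im = - ρ.im := by simp
      rw [hS']
      refine ⟨Metric.closedBall_subset_closedBall (by norm_num) (fz_dist ?_ ?_ ?_), (fzXi_zero_iff1 ?_).1 ?_⟩
      · rw [hre1]; push Not at h3; linarith
      · rw [hre1]; linarith
      · rw [him1, abs_le]; constructor <;> linarith
      · rw [hre1]; linarith
      · rw [fzXi_symm, h0]
    · intros; positivity
  nlinarith

lemma fz_hor_one : ∃ C > 0, ∀ (t : ℝ), 3 ≤ |t| → ∃ H : Finset ℝ, (H.card : ℝ) ≤ C * Real.log |t| ∧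
    ∀ t' δ : ℝ, |t' - t| ≤ 1/2 → 0 < δ → (∀ h ∈ H, δ ≤ |t' - h|) → ∀ σ ∈ Icc (1/2:ℝ) 2,
      fzXi (σ + t' * I) ≠ 0 ∧ ‖logDeriv fzXi (σ + t' * I)‖ ≤ C * Real.log |t| * (1 + 1/δ) := by
  obtain ⟨C, hC, hloc⟩ := fz_local_zeta
  obtain ⟨C', hC', hA⟩ := fzA_bound
  refine ⟨C + 2 * C', by positivity, fun t ht => ?_⟩
  obtain ⟨S, hS, hSc, hL⟩ := hloc t (by linarith)
  have hlogpos : 0 ≤ Real.log |t| := Real.log_nonneg (by linarith)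
  refine ⟨S.image Complex.im, ?_, ?_⟩
  · have h1 : (S.image Complex.im).card ≤ ∑ ρ ∈ S, analyticOrderNatAt riemannZeta₁ ρ := by
      refine Finset.card_image_le.trans ?_
      rw [Finset.card_eq_sum_ones]
      apply Finset.sum_le_sum
      intro ρ hρ
      have hre := fz_dist' ((hS ρ).1 hρ).1
      rw [fzXi_mult' hre]
      exact fzm_pos ((fzXi_zero_iff1 hre).2 ((hS ρ).1 hρ).2)
    calc ((S.image Complex.im).card : ℝ) ≤ ((∑ ρ ∈ S, analyticOrderNatAt riemannZeta₁ ρ : ℕ) : ℝ) := by exact_mod_cast h1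
      _ ≤ C * Real.log |t| := hSc
      _ ≤ _ := by gcongr; linarith
  · intro t' δ htt hδ hH σ hσ
    set z : ℂ := σ + t' * I with hz
    have hzre : z.re = σ := by simp [hz]
    have hzim : z.im = t' := by simp [hz]
    have hpos : 0 < z.re := by rw [hzre]; linarith [hσ.1]
    have hball : z ∈ Metric.closedBall (2 + t * I : ℂ) (8/5) :=
      fz_dist (by rw [hzre]; exact hσ.1) (by rw [hzre]; exact hσ.2) (by rw [hzim]; exact htt)
    have hsep : ∀ ρ ∈ S, δ ≤ ‖z - ρ‖ := by
      intro ρ hρ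
      refine (hH ρ.im (Finset.mem_image_of_mem _ hρ)).trans ?_
      have := Complex.abs_im_le_norm (z - ρ)
      rwa [Complex.sub_im, hzim] at this
    have hz1 : riemannZeta₁ z ≠ 0 := by
      intro h0
      have := hsep z ((hS z).2 ⟨Metric.closedBall_subset_closedBall (by norm_num) hball, h0⟩)
      simp at this; linarith
    refine ⟨fun h => hz1 ((fzXi_zero_iff1 hpos).1 h), ?_⟩
    rw [fzXi_logDeriv hpos hz1]
    have h1 := hL z hball hz1
    have h2 : ‖∑ ρ ∈ S, (analyticOrderNatAt riemannZeta₁ ρ : ℂ)/(z-ρ)‖ ≤ C * Real.log |t| * (1/δ) := by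
      refine (norm_sum_le _ _).trans ?_
      refine le_trans ?_ (mul_le_mul_of_nonneg_right hSc (by positivity))
      push_cast
      rw [Finset.sum_mul]
      apply Finset.sum_le_sum
      intro ρ hρ
      rw [norm_div, Complex.norm_natCast, div_eq_mul_one_div]
      have := hsep ρ hρ
      gcongr
    have ht1 : |t'| ≤ |t| + 1/2 := by
      have := abs_sub_abs_le_abs_sub t' t; linarith
    have ht2 : |t| - 1/2 ≤ |t'| := by
      have := abs_sub_abs_le_abs_sub t t'; rw [abs_sub_comm] at this; linarith
    have h3 := hA z hpos (by rw [hzre]; exact hσ.2) (by rw [hzim]; linarith)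
    have h4 : Real.log |z.im| ≤ 2 * Real.log |t| := by
      have : 2 * Real.log |t| = Real.log (|t|^2) := by rw [Real.log_pow]; norm_num
      rw [this, hzim]; apply Real.log_le_log (by linarith); nlinarith
    have h5 : ‖logDeriv riemannZeta₁ z‖ ≤ C * Real.log |t| + C * Real.log |t| * (1/δ) := by
      have := norm_sub_norm_le (logDeriv riemannZeta₁ z) (∑ ρ ∈ S, (analyticOrderNatAt riemannZeta₁ ρ : ℂ)/(z-ρ))
      linarith
    have h6 : C' * Real.log |z.im| ≤ C' * (2 * Real.log |t|) := by gcongr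
    have h7 : 0 ≤ C' * Real.log |t| * (1/δ) := by positivity
    refine (norm_add_le _ _).trans ?_
    nlinarith

lemma fz_hor : ∃ C > 0, ∀ T : ℝ, 3 ≤ T → ∃ T' ∈ Icc T (T+1), ∀ σ ∈ Icc (-1:ℝ) 2,
    fzXi (σ + T' * I) ≠ 0 ∧ ‖logDeriv fzXi (σ + T' * I)‖ ≤ C * Real.log T ^ 2 := by
  obtain ⟨C, hC, h⟩ := fz_hor_one
  refine ⟨2 * C * (2 * (4 * C + 1) + 1), by positivity, fun T hT => ?_⟩
  set t := T + 1/2 with ht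
  have htp : |t| = t := abs_of_pos (by linarith)
  obtain ⟨H, hH, h1⟩ := h t (by rw [htp]; linarith)
  obtain ⟨H', hH', h1'⟩ := h (-t) (by rw [abs_neg, htp]; linarith)
  rw [abs_neg] at hH' h1'
  rw [htp] at hH hH' h1 h1'
  have hlog : Real.log t ≤ 2 * Real.log T := by
    have : 2 * Real.log T = Real.log (T^2) := by rw [Real.log_pow]; norm_num
    rw [this]; apply Real.log_le_log (by linarith); nlinarith
  have hlT : 1 ≤ Real.log T := by
    rw [Real.le_log_iff_exp_le (by linarith)]; linarith [Real.exp_one_lt_d9]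
  have hlogpos : 0 ≤ Real.log t := Real.log_nonneg (by linarith)
  obtain ⟨T', hT', hgap⟩ := fz_gap (H ∪ H'.image (fun h => -h)) T
  set K := ((H ∪ H'.image (fun h => -h)).card : ℝ) with hK
  have hKle : K ≤ 4 * C * Real.log T := by
    have a1 : (H ∪ H'.image (fun h => -h)).card ≤ H.card + H'.card :=
      (Finset.card_union_le _ _).trans (Nat.add_le_add_left Finset.card_image_le _)
    have a2 : K ≤ (H.card:ℝ) + H'.card := by rw [hK]; exact_mod_cast a1
    nlinarith
  have hKp : 0 ≤ K := by rw [hK]; positivity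
  set δ := 1/(2*(K+1)) with hδ
  have hδp : 0 < δ := by positivity
  have hbound : C * Real.log t * (1 + 1/δ) ≤ 2 * C * (2 * (4 * C + 1) + 1) * Real.log T ^ 2 := by
    have : 1 + 1/δ = 1 + 2*(K+1) := by rw [hδ]; field_simp
    rw [this]
    calc C * Real.log t * (1 + 2*(K+1)) ≤ C * (2 * Real.log T) * (Real.log T + 2 * (4 * C * Real.log T + Real.log T)) := by
          gcongr
      _ = _ := by ring
  refine ⟨T', hT', fun σ hσ => ?_⟩
  have htt : |T' - t| ≤ 1/2 := by rw [abs_le]; constructor <;> linarith [hT'.1, hT'.2]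
  by_cases hσ2 : 1/2 ≤ σ
  · have := h1 T' δ htt hδp (fun h hh => hgap h (Finset.mem_union_left _ hh)) σ ⟨hσ2, hσ.2⟩
    exact ⟨this.1, this.2.trans hbound⟩
  · push Not at hσ2
    have := h1' (-T') δ (by rw [← abs_neg]; convert htt using 2; ring) hδp (fun h hh => by
      have := hgap (-h) (Finset.mem_union_right _ (Finset.mem_image_of_mem _ hh))
      rw [← abs_neg]; convert this using 2; ring) (1-σ) ⟨by linarith, by linarith [hσ.1]⟩
    have e : ((1-σ:ℝ):ℂ) + ((-T':ℝ):ℂ) * I = 1 - (σ + T' * I) := by push_cast; ring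
    rw [e, fzXi_symm, fzXi_logDeriv_symm, norm_neg] at this
    exact ⟨this.1, this.2.trans hbound⟩

/-- rectangle boundary integral -/
noncomputable def fzRect (f : ℂ → ℂ) (a a' b b' : ℝ) : ℂ :=
  (∫ u in a..a', f (u + b * I)) - (∫ u in a..a', f (u + b' * I)) +
    I * (∫ y in b..b', f (a' + y * I)) - I * (∫ y in b..b', f (a + y * I))

lemma fz_log_int (p q : ℂ) (a b : ℝ) (h : ∀ t ∈ uIcc a b, p + t * q ∈ slitPlane) :
    ∫ t in a..b, q / (p + t * q) = Complex.log (p + b * q) - Complex.log (p + a * q) := by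
  have hne : ∀ t ∈ uIcc a b, p + t * q ≠ 0 := fun t ht => Complex.slitPlane_ne_zero (h t ht)
  apply intervalIntegral.integral_eq_sub_of_hasDerivAt (f := fun t : ℝ => Complex.log (p + t * q))
  · intro t ht
    have h1 : HasDerivAt (fun t : ℝ => p + t * q) q t := by
      have := ((hasDerivAt_id t).ofReal_comp.mul_const q).const_add p
      simpa using this
    exact h1.clog_real (h t ht)
  · apply ContinuousOn.intervalIntegrable
    apply ContinuousOn.div continuousOn_const (by fun_prop) hne

lemma fz_rect_inv (ρ : ℂ) (a a' b b' : ℝ) (h1 : a < ρ.re) (h2 : ρ.re < a') (h3 : b < ρ.im) (h4 : ρ.im < b') :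
    fzRect (fun s => 1 / (s - ρ)) a a' b b' = 2 * π * I := by
  unfold fzRect
  have i1 : ∫ u in a..a', 1 / ((u:ℂ) + b * I - ρ) = Complex.log (a' + b * I - ρ) - Complex.log (a + b * I - ρ) := by
    have := fz_log_int (b * I - ρ) 1 a a' (fun t _ => by
      rw [Complex.mem_slitPlane_iff]; right; simp; linarith)
    convert this using 3
    · congr 1; ring
    · ring
    · ring
  have i2 : ∫ u in a..a', 1 / ((u:ℂ) + b' * I - ρ) = Complex.log (a' + b' * I - ρ) - Complex.log (a + b' * I - ρ) := by
    have := fz_log_int (b' * I - ρ) 1 a a' (fun t _ => by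
      rw [Complex.mem_slitPlane_iff]; right; simp; linarith)
    convert this using 3
    · congr 1; ring
    · ring
    · ring
  have i3 : I * ∫ y in b..b', 1 / ((a':ℂ) + y * I - ρ) = Complex.log (a' + b' * I - ρ) - Complex.log (a' + b * I - ρ) := by
    have := fz_log_int (a' - ρ) I b b' (fun t _ => by
      rw [Complex.mem_slitPlane_iff]; left; simp; linarith)
    rw [← intervalIntegral.integral_const_mul]
    have e : ∀ y : ℝ, I * (1 / ((a':ℂ) + y * I - ρ)) = I / (a' - ρ + y * I) := by
      intro y; rw [mul_one_div]; congr 1; ring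
    simp only [e]
    rw [this]
    congr 2 <;> ring
  have i4 : I * ∫ y in b..b', 1 / ((a:ℂ) + y * I - ρ) = Complex.log (-(a + b' * I - ρ)) - Complex.log (-(a + b * I - ρ)) := by
    have := fz_log_int (ρ - a) (-I) b b' (fun t _ => by
      rw [Complex.mem_slitPlane_iff]; left; simp; linarith)
    rw [← intervalIntegral.integral_const_mul]
    have e : ∀ y : ℝ, I * (1 / ((a:ℂ) + y * I - ρ)) = -I / (ρ - a + y * -I) := by
      intro y; rw [mul_one_div, neg_div, ← div_neg]; congr 1; ring
    simp only [e]
    rw [this]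
    congr 2 <;> ring
  rw [i1, i2, i3, i4]
  have e1 : Complex.log (-(a + b' * I - ρ)) = Complex.log (a + b' * I - ρ) - π * I := by
    unfold Complex.log
    rw [Complex.arg_neg_eq_arg_sub_pi_of_im_pos (by simp; linarith), norm_neg]
    push_cast; ring
  have e2 : Complex.log (-(a + b * I - ρ)) = Complex.log (a + b * I - ρ) + π * I := by
    unfold Complex.log
    rw [Complex.arg_neg_eq_arg_add_pi_of_im_neg (by simp; linarith), norm_neg]
    push_cast; ring
  rw [e1, e2]; ring

/-- continuity on the four sides -/
def fzBdCont (f : ℂ → ℂ) (a a' b b' : ℝ) : Prop :=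
  Continuous (fun u : ℝ => f (u + b * I)) ∧ Continuous (fun u : ℝ => f (u + b' * I)) ∧
  Continuous (fun y : ℝ => f (a + y * I)) ∧ Continuous (fun y : ℝ => f (a' + y * I))

/-- points of the boundary -/
def fzBd (a a' b b' : ℝ) : Set ℂ :=
  {z | (z.re ∈ Icc a a' ∧ (z.im = b ∨ z.im = b')) ∨ (z.im ∈ Icc b b' ∧ (z.re = a ∨ z.re = a'))}

lemma fz_rect_congr {f g : ℂ → ℂ} {a a' b b' : ℝ} (ha : a ≤ a') (hb : b ≤ b')
    (h : ∀ z ∈ fzBd a a' b b', f z = g z) : fzRect f a a' b b' = fzRect g a a' b b' := by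
  unfold fzRect
  congr 1
  · congr 1
    · congr 1
      · apply intervalIntegral.integral_congr
        intro u hu
        rw [uIcc_of_le ha] at hu
        apply h; left; simp; exact hu
      · apply intervalIntegral.integral_congr
        intro u hu
        rw [uIcc_of_le ha] at hu
        apply h; left; simp; exact hu
    · congr 1
      apply intervalIntegral.integral_congr
      intro u hu
      rw [uIcc_of_le hb] at hu
      apply h; right; simp; exact hu
  · congr 1
    apply intervalIntegral.integral_congr
    intro u hu
    rw [uIcc_of_le hb] at hu
    apply h; right; simp; exact hu

lemma fz_int_lin {f g : ℝ → ℂ} {a b : ℝ} (hab : a ≤ b) (hf : ContinuousOn f (Icc a b)) (hg : ContinuousOn g (Icc a b)) (c : ℂ) :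
    ∫ t in a..b, (f t + c * g t) = (∫ t in a..b, f t) + c * ∫ t in a..b, g t := by
  rw [← uIcc_of_le hab] at hf hg
  rw [intervalIntegral.integral_add hf.intervalIntegrable (hg.intervalIntegrable.const_mul c),
    intervalIntegral.integral_const_mul]

lemma fz_rect_add {f g : ℂ → ℂ} {a a' b b' : ℝ} (ha : a ≤ a') (hb : b ≤ b') (c : ℂ)
    (hf : ContinuousOn f (fzBd a a' b b')) (hg : ContinuousOn g (fzBd a a' b b')) :
    fzRect (fun z => f z + c * g z) a a' b b' = fzRect f a a' b b' + c * fzRect g a a' b b' := by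
  have side : ∀ φ : ℂ → ℂ, ContinuousOn φ (fzBd a a' b b') →
      ContinuousOn (fun u : ℝ => φ (u + b * I)) (Icc a a') ∧ ContinuousOn (fun u : ℝ => φ (u + b' * I)) (Icc a a') ∧
      ContinuousOn (fun y : ℝ => φ (a + y * I)) (Icc b b') ∧ ContinuousOn (fun y : ℝ => φ (a' + y * I)) (Icc b b') := by
    intro φ hφ
    refine ⟨hφ.comp (by fun_prop) ?_, hφ.comp (by fun_prop) ?_, hφ.comp (by fun_prop) ?_, hφ.comp (by fun_prop) ?_⟩
    · intro u hu; left; simpa using hu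
    · intro u hu; left; simpa using hu
    · intro u hu; right; simpa using hu
    · intro u hu; right; simpa using hu
  obtain ⟨f1, f2, f3, f4⟩ := side f hf
  obtain ⟨g1, g2, g3, g4⟩ := side g hg
  unfold fzRect
  rw [fz_int_lin ha f1 g1, fz_int_lin ha f2 g2, fz_int_lin hb f3 g3, fz_int_lin hb f4 g4]
  ring

lemma fz_rect_sum {ι : Type*} (S : Finset ι) {f : ℂ → ℂ} {g : ι → ℂ → ℂ} (c : ι → ℂ) {a a' b b' : ℝ} (ha : a ≤ a') (hb : b ≤ b')
    (hf : ContinuousOn f (fzBd a a' b b')) (hg : ∀ i ∈ S, ContinuousOn (g i) (fzBd a a' b b')) :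
    fzRect (fun z => f z + ∑ i ∈ S, c i * g i z) a a' b b' = fzRect f a a' b b' + ∑ i ∈ S, c i * fzRect (g i) a a' b b' := by
  classical
  induction S using Finset.induction_on with
  | empty => simp
  | insert i S hi ih =>
    have e : (fun z => f z + ∑ j ∈ insert i S, c j * g j z) = fun z => (f z + ∑ j ∈ S, c j * g j z) + c i * g i z := by
      funext z; rw [Finset.sum_insert hi]; ring
    rw [e, fz_rect_add ha hb, ih (fun j hj => hg j (Finset.mem_insert_of_mem hj)), Finset.sum_insert hi]
    · ring
    · refine hf.add (continuousOn_finset_sum _ fun j hj => continuousOn_const.mul (hg j (Finset.mem_insert_of_mem hj)))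
    · exact hg i (Finset.mem_insert_self _ _)

lemma fzBd_subset {a a' b b' : ℝ} (ha : a ≤ a') (hb : b ≤ b') : fzBd a a' b b' ⊆ (Icc a a') ×ℂ (Icc b b') := by
  intro z hz
  rw [Complex.mem_reProdIm]
  rcases hz with ⟨h1, h2 | h2⟩ | ⟨h1, h2 | h2⟩
  · exact ⟨h1, by rw [h2]; exact left_mem_Icc.2 hb⟩
  · exact ⟨h1, by rw [h2]; exact right_mem_Icc.2 hb⟩
  · exact ⟨by rw [h2]; exact left_mem_Icc.2 ha, h1⟩
  · exact ⟨by rw [h2]; exact right_mem_Icc.2 ha, h1⟩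

lemma fz_rect_residue {x : ℝ} (hx : 0 < x) {a a' b b' : ℝ} (ha : a ≤ 0) (ha' : 1 ≤ a') (hb : b < b')
    (hbot : ∀ σ ∈ Icc a a', fzXi (σ + b * I) ≠ 0) (htop : ∀ σ ∈ Icc a a', fzXi (σ + b' * I) ≠ 0) :
    fzRect (fun s => (x:ℂ)^s * logDeriv fzXi s) a a' b b' =
      2 * π * I * ∑ ρ ∈ fzZ b b', (fzm ρ : ℂ) * (x:ℂ)^ρ := by
  have haa : a ≤ a' := by linarith
  obtain ⟨g, hg, hfac, hgne, -⟩ := fz_factor fzXi_diff fzXi_ne_one (fzZ b b')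
  have hx0 : (x:ℂ) ≠ 0 := by exact_mod_cast hx.ne'
  have hφ : Differentiable ℂ (fun s : ℂ => (x:ℂ)^s) := fun s => by
    apply DifferentiableAt.const_cpow differentiableAt_id (Or.inl hx0)
  have hinner : ∀ ρ ∈ fzZ b b', a < ρ.re ∧ ρ.re < a' ∧ b < ρ.im ∧ ρ.im < b' := by
    intro ρ hρ
    rw [mem_fzZ] at hρ
    obtain ⟨h0, h1, h2⟩ := hρ
    have hre := fzXi_zero_re h0
    refine ⟨by linarith, by linarith, lt_of_le_of_ne h1 ?_, lt_of_le_of_ne h2 ?_⟩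
    · intro h
      apply hbot ρ.re ⟨by linarith, by linarith⟩
      rw [h, Complex.re_add_im, h0]
    · intro h
      apply htop ρ.re ⟨by linarith, by linarith⟩
      rw [← h, Complex.re_add_im, h0]
  have hbdne : ∀ z ∈ fzBd a a' b b', ∀ ρ ∈ fzZ b b', z - ρ ≠ 0 := by
    intro z hz ρ hρ h
    rw [sub_eq_zero] at h; subst h
    obtain ⟨h1, h2, h3, h4⟩ := hinner z hρ
    rcases hz with ⟨_, h | h⟩ | ⟨_, h | h⟩ <;> linarith
  have hgrect : ∀ z ∈ (Icc a a') ×ℂ (Icc b b'), g z ≠ 0 := by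
    intro z hz h0
    rw [Complex.mem_reProdIm] at hz
    have : fzXi z = 0 := by rw [hfac, h0, mul_zero]
    exact hgne z (mem_fzZ.2 ⟨this, hz.2.1, hz.2.2⟩) h0
  have hbdxi : ∀ z ∈ fzBd a a' b b', fzXi z ≠ 0 := by
    intro z hz h0
    have := fzBd_subset haa hb.le hz
    rw [Complex.mem_reProdIm] at this
    exact hbdne z hz z (mem_fzZ.2 ⟨h0, this.2.1, this.2.2⟩) (sub_self z)
  let φ : ℂ → ℂ := fun s => (x:ℂ)^s
  have hds : ∀ ρ, Differentiable ℂ (dslope φ ρ) := by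
    intro ρ
    rw [← differentiableOn_univ, Complex.differentiableOn_dslope Filter.univ_mem]
    exact hφ.differentiableOn
  let h : ℂ → ℂ := fun z => φ z * logDeriv g z + ∑ ρ ∈ fzZ b b', (fzm ρ : ℂ) * dslope φ ρ z
  have hhd : DifferentiableOn ℂ h ((Icc a a') ×ℂ (Icc b b')) := by
    intro z hz
    apply DifferentiableAt.differentiableWithinAt
    apply DifferentiableAt.add
    · apply (hφ z).mul
      unfold logDeriv
      exact (hg.deriv z).div (hg z) (hgrect z hz)
    · exact DifferentiableAt.fun_sum (fun ρ _ => (hds ρ z).const_mul _)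
  have e1 : fzRect (fun s => (x:ℂ)^s * logDeriv fzXi s) a a' b b' =
      fzRect (fun z => h z + ∑ ρ ∈ fzZ b b', ((fzm ρ : ℂ) * (x:ℂ)^ρ) * (1/(z-ρ))) a a' b b' := by
    apply fz_rect_congr haa hb.le
    intro z hz
    rw [fz_logDeriv_factor hg (fzZ b b') (fun ρ => analyticOrderNatAt fzXi ρ) hfac (hbdxi z hz)]
    simp only [h]
    rw [mul_add, Finset.mul_sum, add_comm, add_assoc, ← Finset.sum_add_distrib]
    congr 1
    apply Finset.sum_congr rfl
    intro ρ hρ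
    have hne := hbdne z hz ρ hρ
    rw [dslope_of_ne _ (sub_ne_zero.1 hne), slope_def_field]
    simp only [φ, fzm]
    field_simp
    ring
  rw [e1, fz_rect_sum _ _ haa hb.le (hhd.continuousOn.mono (fzBd_subset haa hb.le))]
  · have e2 : fzRect h a a' b b' = 0 := by
      have := Complex.integral_boundary_rect_eq_zero_of_differentiableOn h (a + b * I) (a' + b' * I) (by
        simpa [uIcc_of_le haa, uIcc_of_le hb.le] using hhd)
      simpa [fzRect] using this
    rw [e2, zero_add, Finset.mul_sum]
    apply Finset.sum_congr rfl
    intro ρ hρ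
    obtain ⟨h1, h2, h3, h4⟩ := hinner ρ hρ
    rw [fz_rect_inv ρ a a' b b' h1 h2 h3 h4]; ring
  · intro ρ hρ
    apply ContinuousOn.div continuousOn_const (by fun_prop)
    intro z hz
    exact hbdne z hz ρ hρ

/-- oscillatory integral -/
noncomputable def fzK (u b b' : ℝ) : ℂ := ∫ y in b..b', Complex.exp ((I * u) * y)

lemma fz_exp_norm (u y : ℝ) : ‖Complex.exp ((I * u) * y)‖ = 1 := by
  rw [Complex.norm_exp]; simp

lemma fzK_bound {u : ℝ} (hu : u ≠ 0) (b b' : ℝ) : ‖fzK u b b'‖ ≤ 2 / |u| := by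
  unfold fzK
  have hu' : I * (u:ℂ) ≠ 0 := mul_ne_zero I_ne_zero (by exact_mod_cast hu)
  rw [integral_exp_mul_complex hu', norm_div, norm_mul, Complex.norm_I, one_mul, Complex.norm_real, Real.norm_eq_abs]
  gcongr
  refine (norm_sub_le _ _).trans ?_
  rw [fz_exp_norm, fz_exp_norm]; norm_num

/-- archimedean part plus the pole -/
noncomputable def fzA2 (s : ℂ) : ℂ := fzA s + 1 / (s - 1)

lemma fz_ne_one {s : ℂ} (hs : 1 < s.re) : s - 1 ≠ 0 := by
  intro h; rw [sub_eq_zero] at h; rw [h] at hs; simp at hs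

lemma fzA2_hasDeriv {s : ℂ} (hs : 1 < s.re) : HasDerivAt fzA2 (fzA1 s - 1/(s-1)^2) s := by
  have h1 := ((hasDerivAt_id s).sub_const (1:ℂ)).inv (fz_ne_one hs)
  have h2 := (fzA_hasDeriv (by linarith : 0 < s.re)).add h1
  have h3 : fzA2 = fzA + (fun z => id z - 1)⁻¹ := by funext z; simp [fzA2]
  rw [h3]
  refine h2.congr_deriv ?_
  simp [neg_div]; ring

lemma fzA2_deriv_cont : ContinuousOn (deriv fzA2) {s : ℂ | 1 < s.re} := by
  have h : DifferentiableOn ℂ fzA2 {s : ℂ | 1 < s.re} := fun s hs => (fzA2_hasDeriv hs).differentiableAt.differentiableWithinAt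
  exact (h.deriv (isOpen_lt continuous_const Complex.continuous_re)).continuousOn

lemma fz_im_norm {s : ℂ} : |s.im| ≤ ‖s - 1‖ := by
  have := Complex.abs_im_le_norm (s - 1); simpa using this

lemma fzA2_deriv_bound {s : ℂ} (hs : 1 < s.re) (ht : 1 ≤ |s.im|) : ‖deriv fzA2 s‖ ≤ 2 / |s.im| := by
  rw [(fzA2_hasDeriv hs).deriv]
  have h1 := fzA1_bound (by linarith : 0 < s.re) (by rw [← abs_pos]; linarith)
  have h2 : ‖1/(s-1)^2‖ ≤ 1/|s.im| := by
    rw [norm_div, norm_one, norm_pow]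
    have := fz_im_norm (s := s)
    apply one_div_le_one_div_of_le (by linarith)
    nlinarith
  calc _ ≤ _ := norm_sub_le _ _
    _ ≤ 1/|s.im| + 1/|s.im| := add_le_add h1 h2
    _ = _ := by ring

lemma fz_arch : ∃ C > 0, ∀ c ε b b' x : ℝ, 1 < c → c ≤ 2 → |ε| = 1 → 3 ≤ b → b ≤ b' → 1 < x →
    ‖∫ y in b..b', fzA2 (c + (ε * y : ℝ) * I) * Complex.exp ((I * (Real.log x : ℝ)) * y)‖ ≤
      C * Real.log b' / Real.log x := by
  obtain ⟨C, hC, hA⟩ := fzA_bound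
  refine ⟨2 * (C + 1) + 2, by positivity, fun c ε b b' x hc hc2 hε hb hbb hx => ?_⟩
  have hlx : 0 < Real.log x := Real.log_pos hx
  have hlx' : I * ((Real.log x : ℝ) : ℂ) ≠ 0 := mul_ne_zero I_ne_zero (by exact_mod_cast hlx.ne')
  let p : ℝ → ℂ := fun y => c + (ε * y : ℝ) * I
  have hpre : ∀ y, (p y).re = c := fun y => by simp [p]
  have hpim : ∀ y, (p y).im = ε * y := fun y => by simp [p]
  have hpabs : ∀ y ∈ Icc b b', |(p y).im| = y := by
    intro y hy; rw [hpim, abs_mul, hε, one_mul, abs_of_pos (by linarith [hy.1])]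
  have hp : ∀ y, HasDerivAt p (ε * I) y := by
    intro y
    have := ((((hasDerivAt_id y).const_mul ε).ofReal_comp).mul_const I).const_add (c:ℂ)
    refine HasDerivAt.congr_deriv (f := p) this ?_
    simp
  have hpc : Continuous p := by fun_prop
  have hu : ∀ y ∈ uIcc b b', HasDerivAt (fun y => fzA2 (p y)) (deriv fzA2 (p y) * (ε * I)) y := by
    intro y _
    exact (fzA2_hasDeriv (by rw [hpre]; exact hc)).differentiableAt.hasDerivAt.comp y (hp y)
  have hv : ∀ y ∈ uIcc b b', HasDerivAt (fun y : ℝ => Complex.exp ((I * (Real.log x : ℝ)) * y) / (I * (Real.log x : ℝ)))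
      (Complex.exp ((I * (Real.log x : ℝ)) * y)) y := by
    intro y _
    have h1 : HasDerivAt (fun y : ℝ => (I * (Real.log x : ℝ)) * (y:ℂ)) (I * (Real.log x : ℝ)) y := by
      simpa using ((hasDerivAt_id y).ofReal_comp).const_mul (I * ((Real.log x : ℝ):ℂ))
    have h2 := h1.cexp.div_const (I * ((Real.log x : ℝ):ℂ))
    refine h2.congr_deriv ?_
    exact mul_div_cancel_right₀ _ hlx'
  have hu'c : Continuous (fun y => deriv fzA2 (p y) * (ε * I)) := by
    refine Continuous.mul ?_ continuous_const
    rw [← continuousOn_univ]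
    exact fzA2_deriv_cont.comp hpc.continuousOn (fun y _ => by
      show 1 < (p y).re
      rw [hpre]; exact hc)
  have hibp := intervalIntegral.integral_mul_deriv_eq_deriv_mul hu hv (hu'c.intervalIntegrable _ _)
    ((by fun_prop : Continuous fun y : ℝ => Complex.exp ((I * (Real.log x : ℝ)) * y)).intervalIntegrable _ _)
  have hM : ∀ y ∈ Icc b b', ‖fzA2 (p y)‖ ≤ (C + 1) * Real.log b' := by
    intro y hy
    have h1 := hA (p y) (by rw [hpre]; linarith) (by rw [hpre]; exact hc2) (by rw [hpabs y hy]; linarith [hy.1])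
    rw [hpabs y hy] at h1
    have h2 : ‖1/(p y - 1)‖ ≤ 1 := by
      rw [norm_div, norm_one]
      have := fz_im_norm (s := p y)
      rw [hpabs y hy] at this
      rw [div_le_one (by linarith [hy.1])]; linarith [hy.1]
    have h3 : Real.log y ≤ Real.log b' := Real.log_le_log (by linarith [hy.1]) hy.2
    have h4 : 1 ≤ Real.log b' := by
      rw [Real.le_log_iff_exp_le (by linarith)]; linarith [Real.exp_one_lt_d9]
    calc _ ≤ _ := norm_add_le _ _
      _ ≤ C * Real.log b' + 1 * Real.log b' := by nlinarith
      _ = _ := by ring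
  have hvn : ∀ y : ℝ, ‖Complex.exp ((I * (Real.log x : ℝ)) * y) / (I * (Real.log x : ℝ))‖ = 1 / Real.log x := by
    intro y
    rw [norm_div, fz_exp_norm, norm_mul, Complex.norm_I, one_mul, Complex.norm_real, Real.norm_eq_abs, abs_of_pos hlx]
  have hinner : ‖∫ y in b..b', (deriv fzA2 (p y) * (ε * I)) * (Complex.exp ((I * (Real.log x : ℝ)) * y) / (I * (Real.log x : ℝ)))‖ ≤
      2 * Real.log b' / Real.log x := by
    have : ‖∫ y in b..b', (deriv fzA2 (p y) * (ε * I)) * (Complex.exp ((I * (Real.log x : ℝ)) * y) / (I * (Real.log x : ℝ)))‖ ≤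
        ∫ y in b..b', (2 / Real.log x) * y⁻¹ := by
      apply intervalIntegral.norm_integral_le_of_norm_le hbb
      · filter_upwards with y hy
        have hy' : y ∈ Icc b b' := ⟨hy.1.le, hy.2⟩
        rw [norm_mul, norm_mul, hvn, norm_mul, Complex.norm_I, Complex.norm_real, Real.norm_eq_abs, hε]
        have := fzA2_deriv_bound (s := p y) (by rw [hpre]; exact hc) (by rw [hpabs y hy']; linarith [hy'.1])
        rw [hpabs y hy'] at this
        calc _ ≤ 2 / y * (1*1) * (1 / Real.log x) := by gcongr
          _ = _ := by ring
      · apply ContinuousOn.intervalIntegrable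
        rw [uIcc_of_le hbb]
        exact continuousOn_const.mul (continuousOn_id.inv₀ (fun y hy => by simp; linarith [hy.1]))
    refine this.trans ?_
    rw [intervalIntegral.integral_const_mul, integral_inv_of_pos (by linarith) (by linarith)]
    have hl : Real.log (b'/b) ≤ Real.log b' := by
      apply Real.log_le_log (div_pos (by linarith) (by linarith))
      rw [div_le_iff₀ (by linarith)]; nlinarith
    calc 2 / Real.log x * Real.log (b'/b) ≤ 2 / Real.log x * Real.log b' := by gcongr
      _ = _ := by ring
  rw [hibp]
  have hb1 := hM b (left_mem_Icc.2 hbb)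
  have hb2 := hM b' (right_mem_Icc.2 hbb)
  calc _ ≤ _ := norm_sub_le _ _
    _ ≤ ((C + 1) * Real.log b' * (1 / Real.log x) + (C + 1) * Real.log b' * (1 / Real.log x)) + 2 * Real.log b' / Real.log x := by
      gcongr
      refine (norm_sub_le _ _).trans ?_
      rw [norm_mul, norm_mul, hvn, hvn]
      gcongr
    _ = _ := by ring

/-- Dirichlet coefficients -/
noncomputable def fzLam (c : ℝ) (n : ℕ) : ℝ := ArithmeticFunction.vonMangoldt n * (n:ℝ)^(-c)

/-- the Dirichlet series of von Mangoldt -/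
noncomputable def fzLS (s : ℂ) : ℂ := LSeries (fun n => (ArithmeticFunction.vonMangoldt n : ℂ)) s

lemma fzLam_nonneg (c : ℝ) (n : ℕ) : 0 ≤ fzLam c n :=
  mul_nonneg ArithmeticFunction.vonMangoldt_nonneg (by positivity)

lemma fzLS_hasSum {s : ℂ} (hs : 1 < s.re) :
    HasSum (fun n : ℕ => (fzLam s.re n : ℂ) * Complex.exp (-(I * s.im * (Real.log n : ℝ)))) (fzLS s) := by
  have h := (ArithmeticFunction.LSeriesSummable_vonMangoldt hs).LSeriesHasSum
  refine HasSum.congr_fun (f := LSeries.term (fun n => (ArithmeticFunction.vonMangoldt n : ℂ)) s) h ?_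
  intro n
  rw [LSeries.term_def]
  split_ifs with hn
  · simp [hn, fzLam]
  · have hn0 : (n:ℂ) ≠ 0 := by exact_mod_cast hn
    have hnp : (0:ℝ) < n := by positivity
    rw [Complex.cpow_def_of_ne_zero hn0, div_eq_mul_inv, ← Complex.exp_neg]
    unfold fzLam
    rw [Real.rpow_def_of_pos hnp]
    push_cast
    rw [mul_assoc, ← Complex.exp_add]
    congr 2
    rw [← Complex.natCast_log]
    simp only [Complex.natCast_log]
    linear_combination (-(Complex.log n)) * (Complex.re_add_im s)

lemma fzLam_summable {c : ℝ} (hc : 1 < c) : Summable (fzLam c) := by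
  have h := (fzLS_hasSum (s := c) (by simpa using hc)).summable.norm
  refine h.congr (fun n => ?_)
  simp [abs_of_nonneg (fzLam_nonneg c n)]

lemma fz_logDeriv_zeta1 {s : ℂ} (hs : 1 < s.re) : logDeriv riemannZeta₁ s = 1 / (s - 1) - fzLS s := by
  have hs1 : s ≠ 1 := by rintro rfl; simp at hs
  have e : riemannZeta₁ =ᶠ[nhds s] fun w => (w - 1) * riemannZeta w := by
    filter_upwards [isOpen_ne.mem_nhds hs1] with z hz using fz_zeta1_of_ne hz
  have h1 : logDeriv riemannZeta₁ s = logDeriv (fun w => (w - 1) * riemannZeta w) s := by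
    rw [logDeriv_apply, logDeriv_apply, e.deriv_eq, e.eq_of_nhds]
  rw [h1, logDeriv_mul (f := fun w : ℂ => w - 1) s (sub_ne_zero.2 hs1) (riemannZeta_ne_zero_of_one_le_re hs.le) (by fun_prop)
    (differentiableAt_riemannZeta hs1)]
  unfold fzLS
  rw [ArithmeticFunction.LSeries_vonMangoldt_eq_deriv_riemannZeta_div hs, logDeriv_apply, logDeriv_apply]
  simp
  ring

lemma fz_logDeriv_xi {s : ℂ} (hs : 1 < s.re) : logDeriv fzXi s = fzA2 s - fzLS s := by
  rw [fzXi_logDeriv (by linarith) (fz_zeta1_ne hs.le), fz_logDeriv_zeta1 hs]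
  unfold fzA2; ring

lemma fzLam_tsum : ∃ C > 0, ∀ c : ℝ, 1 < c → c ≤ 2 → ∑' n, fzLam c n ≤ C / (c - 1) := by
  have hcont : ContinuousOn (fun c : ℝ => logDeriv riemannZeta₁ (c:ℂ)) (Icc 1 2) := by
    unfold logDeriv
    apply ContinuousOn.div
    · exact ((differentiable_riemannZeta₁.contDiff (n := 1)).continuous_deriv le_rfl |>.comp continuous_ofReal).continuousOn
    · exact (differentiable_riemannZeta₁.continuous.comp continuous_ofReal).continuousOn
    · intro c hc; exact fz_zeta1_ne (by simpa using hc.1)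
  obtain ⟨K, hK⟩ := isCompact_Icc.exists_bound_of_continuousOn hcont
  have hK0 : 0 ≤ K := (norm_nonneg _).trans (hK 1 (by simp))
  refine ⟨1 + K, by positivity, fun c hc hc2 => ?_⟩
  have h1 := fzLS_hasSum (s := c) (by simpa using hc)
  have h2 : HasSum (fun n : ℕ => (fzLam c n : ℂ)) (fzLS c) := by
    refine HasSum.congr_fun h1 ?_
    intro n; simp
  have h3 : ((∑' n, fzLam c n : ℝ) : ℂ) = fzLS c := by
    rw [Complex.ofReal_tsum]; exact h2.tsum_eq
  have h4 := fz_logDeriv_zeta1 (s := c) (by simpa using hc)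
  have h5 : ‖fzLS c‖ ≤ 1/(c-1) + K := by
    have : fzLS c = 1/((c:ℂ)-1) - logDeriv riemannZeta₁ c := by rw [h4]; ring
    rw [this]
    refine (norm_sub_le _ _).trans (add_le_add (le_of_eq ?_) (hK c ⟨hc.le, hc2⟩))
    rw [norm_div, norm_one, ← Complex.ofReal_one, ← Complex.ofReal_sub, Complex.norm_real, Real.norm_eq_abs, abs_of_pos (by linarith)]
  rw [← h3, Complex.norm_real, Real.norm_eq_abs, abs_of_nonneg (tsum_nonneg (fzLam_nonneg c))] at h5
  refine h5.trans ?_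
  rw [add_div]
  gcongr
  rw [le_div_iff₀ (by linarith)]
  nlinarith

lemma fz_dir {c ε b b' x : ℝ} (hc : 1 < c) :
    HasSum (fun n : ℕ => (fzLam c n : ℂ) * fzK (Real.log x - ε * Real.log n) b b')
      (∫ y in b..b', fzLS (c + (ε * y : ℝ) * I) * Complex.exp ((I * (Real.log x : ℝ)) * y)) := by
  have h := intervalIntegral.hasSum_integral_of_dominated_convergence (a := b) (b := b') (μ := volume)
    (F := fun (n:ℕ) (y:ℝ) => (fzLam c n : ℂ) * Complex.exp ((I * (Real.log x - ε * Real.log n : ℝ)) * y))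
    (f := fun y => fzLS (c + (ε * y : ℝ) * I) * Complex.exp ((I * (Real.log x : ℝ)) * y))
    (fun n _ => fzLam c n)
    (fun n => (by fun_prop : Continuous _).aestronglyMeasurable)
    (fun n => by
      filter_upwards with y _
      rw [norm_mul, fz_exp_norm, mul_one, Complex.norm_real, Real.norm_eq_abs, abs_of_nonneg (fzLam_nonneg c n)])
    (by filter_upwards with y _ using fzLam_summable hc)
    (intervalIntegrable_const)
    (by
      filter_upwards with y _
      have h1 := (fzLS_hasSum (s := (c + (ε * y : ℝ) * I : ℂ)) (by simpa using hc)).mul_right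
        (Complex.exp ((I * (Real.log x : ℝ)) * y))
      refine HasSum.congr_fun h1 ?_
      intro n
      have e1 : ((c:ℂ) + (ε * y : ℝ) * I).re = c := by simp
      have e2 : ((c:ℂ) + (ε * y : ℝ) * I).im = ε * y := by simp
      rw [e1, e2, mul_assoc (fzLam c n : ℂ), ← Complex.exp_add]
      congr 2
      push_cast; ring)
  refine HasSum.congr_fun h ?_
  intro n
  rw [intervalIntegral.integral_const_mul]; rfl

/-- nearest prime power -/
def fzNear (x : ℝ) (n : ℕ) : Prop := IsPrimePow n ∧ ∀ m : ℕ, IsPrimePow m → |x - (n : ℝ)| ≤ |x - (m : ℝ)|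

lemma fzNear_le {x : ℝ} (hx : 1 < x) {n : ℕ} (hn : fzNear x n) : (n:ℝ) ≤ 2 * x := by
  set N := ⌊x⌋₊ with hN
  have hN1 : 1 ≤ N := Nat.le_floor (by simpa using hx.le)
  have hNx : (N:ℝ) ≤ x := Nat.floor_le (by linarith)
  set k := Nat.log 2 N
  have h1 : 2^k ≤ N := Nat.pow_log_le_self 2 (by omega)
  have h2 : N < 2^(k+1) := Nat.lt_pow_succ_log_self (by norm_num) N
  have h3 : x < ((2^(k+1) : ℕ) : ℝ) := by
    rw [← Nat.floor_lt (by linarith)]; exact h2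
  have h4 : ((2^(k+1) : ℕ) : ℝ) ≤ 2 * x := by
    have : ((2^k : ℕ):ℝ) ≤ N := by exact_mod_cast h1
    push_cast at *
    rw [pow_succ]; linarith
  have h5 : IsPrimePow (2^(k+1)) := by
    rw [isPrimePow_nat_iff]; exact ⟨2, k+1, Nat.prime_two, by omega, rfl⟩
  have h6 := hn.2 _ h5
  rw [abs_of_neg (show x - ((2^(k+1):ℕ):ℝ) < 0 by linarith)] at h6
  have := neg_abs_le (x - n)
  linarith

lemma fz_harm (N M : ℕ) : ∑ k ∈ Finset.range M, 1/(|(k:ℝ)-N|+1) ≤ (harmonic N : ℝ) + (harmonic M : ℝ) := by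
  have hh : ∀ n : ℕ, (harmonic n : ℝ) = ∑ i ∈ Finset.range n, 1/((i:ℝ)+1) := by
    intro n; unfold harmonic; push_cast; simp
  calc ∑ k ∈ Finset.range M, 1/(|(k:ℝ)-N|+1) ≤ ∑ k ∈ Finset.range (N+M), 1/(|(k:ℝ)-N|+1) := by
        apply Finset.sum_le_sum_of_subset_of_nonneg
        · intro k hk; rw [Finset.mem_range] at *; omega
        · intros; positivity
    _ = ∑ k ∈ Finset.range N, 1/(|(k:ℝ)-N|+1) + ∑ k ∈ Finset.range M, 1/(|((N+k:ℕ):ℝ)-N|+1) := by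
        rw [Finset.sum_range_add]
    _ ≤ _ := by
        rw [hh, hh]
        apply add_le_add
        · rw [← Finset.sum_range_reflect]
          apply Finset.sum_le_sum
          intro k hk
          rw [Finset.mem_range] at hk
          have : ((N - 1 - k : ℕ):ℝ) = N - 1 - k := by
            rw [Nat.cast_sub (by omega), Nat.cast_sub (by omega)]; simp
          rw [this]
          apply one_div_le_one_div_of_le (by positivity)
          have := neg_abs_le ((N:ℝ) - 1 - k - N)
          linarith
        · apply Finset.sum_le_sum
          intro k hk
          push_cast
          rw [add_sub_cancel_left, abs_of_nonneg (by positivity)]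

lemma fz_log_diff {x k : ℝ} (hx : 0 < x) (hk : 0 < k) (h2 : k ≤ 2 * x) :
    |x - k| / (2 * x) ≤ |Real.log x - Real.log k| := by
  rcases le_total k x with h | h
  · rw [abs_of_nonneg (by linarith), abs_of_nonneg (by linarith [Real.log_le_log hk h]), ← Real.log_div hx.ne' hk.ne']
    have := Real.one_sub_inv_le_log_of_pos (div_pos hx hk)
    refine le_trans ?_ this
    rw [inv_div, div_le_iff₀ (by linarith)]
    have : (1 - k/x) * (2 * x) = 2 * (x - k) := by field_simp
    rw [this]; linarith
  · rw [abs_of_nonpos (by linarith), abs_of_nonpos (by linarith [Real.log_le_log hx h]), neg_sub, neg_sub, ← Real.log_div hk.ne' hx.ne']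
    have := Real.one_sub_inv_le_log_of_pos (div_pos hk hx)
    refine le_trans ?_ this
    rw [inv_div, div_le_iff₀ (by linarith)]
    have : (1 - x/k) * (2 * x) = (k - x) * (2 * x / k) := by field_simp
    rw [this]
    have : 1 ≤ 2 * x / k := by rw [le_div_iff₀ hk]; linarith
    nlinarith

lemma fz_exp_diff (v : ℝ) : |Real.exp v - 1| ≤ |v| * (1 + Real.exp v) := by
  have h1 := Real.add_one_le_exp v
  have h2 := Real.add_one_le_exp (-v)
  have h3 : Real.exp (-v) * Real.exp v = 1 := by rw [← Real.exp_add]; simp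
  have hp := Real.exp_pos v
  rcases le_total 0 v with h | h
  · rw [abs_of_nonneg h, abs_of_nonneg (by linarith)]
    nlinarith
  · rw [abs_of_nonpos h, abs_of_nonpos (by linarith [Real.exp_le_one_iff.2 h])]
    nlinarith

/-- the abscissa -/
noncomputable def fzc (x : ℝ) : ℝ := 1 + 1 / Real.log (3 * x)

lemma fz_log3x {x : ℝ} (hx : 1 < x) : 1 < Real.log (3 * x) := by
  rw [Real.lt_log_iff_exp_lt (by linarith)]
  linarith [Real.exp_one_lt_d9]

lemma fzc_gt {x : ℝ} (hx : 1 < x) : 1 < fzc x := by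
  have := fz_log3x hx
  unfold fzc
  have : 0 < 1 / Real.log (3 * x) := by positivity
  linarith

lemma fzc_le {x : ℝ} (hx : 1 < x) : fzc x ≤ 2 := by
  have := fz_log3x hx
  unfold fzc
  have : 1 / Real.log (3 * x) ≤ 1 := by rw [div_le_one (by linarith)]; exact this.le
  linarith

lemma fzc_pow {x : ℝ} (hx : 1 < x) : x ^ (fzc x) ≤ 3 * x := by
  have h3 := fz_log3x hx
  unfold fzc
  rw [Real.rpow_add (by linarith), Real.rpow_one, mul_comm]
  gcongr
  rw [Real.rpow_def_of_pos (by linarith)]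
  have : Real.log x * (1 / Real.log (3 * x)) ≤ 1 := by
    rw [mul_one_div, div_le_one (by linarith)]
    apply Real.log_le_log <;> linarith
  have := Real.exp_le_exp.2 this
  linarith [Real.exp_one_lt_d9]

lemma fzK_sub (u b b' T : ℝ) : fzK u b b' - fzK u 0 T = fzK u T b' - fzK u 0 b := by
  have hi : ∀ p q : ℝ, IntervalIntegrable (fun y : ℝ => Complex.exp ((I * u) * y)) volume p q :=
    fun p q => (by fun_prop : Continuous _).intervalIntegrable _ _
  unfold fzK
  have h1 := intervalIntegral.integral_add_adjacent_intervals (hi 0 b) (hi b b')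
  have h2 := intervalIntegral.integral_add_adjacent_intervals (hi 0 T) (hi T b')
  linear_combination h1 - h2

lemma fzK_triv (u b b' : ℝ) (h : b ≤ b') : ‖fzK u b b'‖ ≤ b' - b := by
  unfold fzK
  have := intervalIntegral.norm_integral_le_of_norm_le_const (a := b) (b := b') (C := 1)
    (f := fun y : ℝ => Complex.exp ((I * u) * y)) (fun y _ => (fz_exp_norm u y).le)
  rwa [one_mul, abs_of_nonneg (by linarith)] at this

/-- the term of the nearest prime power -/
lemma fz_near_term {x : ℝ} (hx : 1 < x) {n : ℕ} (hn : fzNear x n) {b b' T : ℝ} (hb : 0 ≤ b) (hb4 : b ≤ 4)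
    (hT : T ≤ b') (hT1 : b' ≤ T + 1) :
    ‖((x ^ (fzc x) : ℝ) : ℂ) * ((fzLam (fzc x) n : ℂ) * fzK (Real.log x - 1 * Real.log n) b b') -
      (ArithmeticFunction.vonMangoldt n : ℂ) * fzK (Real.log (x / n)) 0 T‖ ≤ 21 * x * Real.log (3 * x) := by
  have hn0 : n ≠ 0 := hn.1.ne_zero
  have hnp : (1:ℝ) ≤ n := by exact_mod_cast Nat.one_le_iff_ne_zero.2 hn0
  have hn2 := fzNear_le hx hn
  set c := fzc x with hc
  have hc1 := fzc_gt hx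
  have hc2 := fzc_le hx
  set u := Real.log x - 1 * Real.log n with hu
  have hu' : Real.log (x / n) = u := by rw [hu, Real.log_div (by linarith) (by linarith), one_mul]
  rw [hu']
  have hΛ0 : 0 ≤ ArithmeticFunction.vonMangoldt n := ArithmeticFunction.vonMangoldt_nonneg
  have hΛ : ArithmeticFunction.vonMangoldt n ≤ Real.log (3 * x) :=
    ArithmeticFunction.vonMangoldt_le_log.trans (Real.log_le_log (by linarith) (by linarith))
  have hE : x ^ c * (n:ℝ)^(-c) = Real.exp (c * u) := by
    rw [Real.rpow_def_of_pos (by linarith), Real.rpow_def_of_pos (by linarith), ← Real.exp_add, hu]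
    congr 1; ring
  have hE2 : Real.exp (c * u) ≤ 3 * x := by
    rw [← hE]
    have h1 : (n:ℝ)^(-c) ≤ 1 := Real.rpow_le_one_of_one_le_of_nonpos hnp (by linarith)
    have h2 := fzc_pow hx
    have h3 : 0 ≤ x ^ c := by positivity
    nlinarith
  have e : ((x ^ c : ℝ) : ℂ) * ((fzLam c n : ℂ) * fzK u b b') - (ArithmeticFunction.vonMangoldt n : ℂ) * fzK u 0 T =
      (ArithmeticFunction.vonMangoldt n : ℂ) * (((Real.exp (c * u) - 1 : ℝ) : ℂ) * fzK u b b' + (fzK u T b' - fzK u 0 b)) := by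
    rw [← fzK_sub, ← hE]
    unfold fzLam
    push_cast; ring
  rw [e, norm_mul, Complex.norm_real, Real.norm_eq_abs, abs_of_nonneg hΛ0]
  have h1 : ‖((Real.exp (c * u) - 1 : ℝ) : ℂ) * fzK u b b'‖ ≤ 16 * x := by
    by_cases hu0 : u = 0
    · simp [hu0]; linarith
    · rw [norm_mul, Complex.norm_real, Real.norm_eq_abs]
      have a1 := fz_exp_diff (c * u)
      have a2 := fzK_bound hu0 b b'
      have a3 : 0 < |u| := abs_pos.2 hu0
      calc _ ≤ (|c * u| * (1 + Real.exp (c * u))) * (2 / |u|) := by gcongr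
        _ = 2 * c * (1 + Real.exp (c * u)) := by rw [abs_mul, abs_of_pos (by linarith : 0 < c)]; field_simp
        _ ≤ 2 * 2 * (1 + 3 * x) := by gcongr
        _ ≤ _ := by linarith
  have h2 : ‖fzK u T b' - fzK u 0 b‖ ≤ 5 := by
    have := norm_sub_le (fzK u T b') (fzK u 0 b)
    have := fzK_triv u T b' hT
    have := fzK_triv u 0 b hb
    linarith
  have h3 := norm_add_le (((Real.exp (c * u) - 1 : ℝ) : ℂ) * fzK u b b') (fzK u T b' - fzK u 0 b)
  calc _ ≤ Real.log (3 * x) * (21 * x) := by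
        apply mul_le_mul hΛ (by linarith) (norm_nonneg _) (by linarith [fz_log3x hx])
    _ = _ := by ring

lemma fz_other_term {x : ℝ} (hx : 1 < x) {n : ℕ} (hn : fzNear x n) (b b' : ℝ) (k : ℕ) (hk : k ≠ n) :
    ‖((x ^ (fzc x) : ℝ) : ℂ) * ((fzLam (fzc x) k : ℂ) * fzK (Real.log x - 1 * Real.log k) b b')‖ ≤
      3 * x ^ (fzc x) * fzLam (fzc x) k +
        (if k ∈ Finset.range ⌈2 * x⌉₊ then 80 * x * Real.log (3 * x) * (1 / (|(k:ℝ) - (⌊x⌋₊:ℕ)| + 1)) else 0) := by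
  set c := fzc x with hc
  have hc1 := fzc_gt hx
  have hc2 := fzc_le hx
  have hXc : 0 ≤ x ^ c := by positivity
  have hL := fzLam_nonneg c k
  have hl3 := fz_log3x hx
  have hsecond : 0 ≤ (if k ∈ Finset.range ⌈2 * x⌉₊ then 80 * x * Real.log (3 * x) * (1 / (|(k:ℝ) - (⌊x⌋₊:ℕ)| + 1)) else 0) := by
    split_ifs
    · positivity
    · exact le_rfl
  have hfirst : 0 ≤ 3 * x ^ c * fzLam c k := by positivity
  rw [norm_mul, norm_mul, Complex.norm_real, Complex.norm_real, Real.norm_eq_abs, Real.norm_eq_abs, abs_of_nonneg hXc,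
    abs_of_nonneg hL]
  by_cases hΛ : ArithmeticFunction.vonMangoldt k = 0
  · have : fzLam c k = 0 := by unfold fzLam; rw [hΛ, zero_mul]
    rw [this]; simp only [zero_mul, mul_zero, zero_add]; exact hsecond
  have hpp : IsPrimePow k := ArithmeticFunction.vonMangoldt_ne_zero_iff.1 hΛ
  have hk0 : k ≠ 0 := hpp.ne_zero
  have hkp : (1:ℝ) ≤ k := by exact_mod_cast Nat.one_le_iff_ne_zero.2 hk0
  rw [one_mul]
  by_cases hfar : Real.log 2 ≤ |Real.log x - Real.log k|
  · have hl2 := Real.log_two_gt_d9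
    have hne : Real.log x - Real.log k ≠ 0 := by rw [← abs_pos]; linarith
    have h1 := fzK_bound hne b b'
    have h2 : 2 / |Real.log x - Real.log k| ≤ 3 := by
      rw [div_le_iff₀ (by linarith)]; linarith
    calc _ ≤ x ^ c * (fzLam c k * 3) := by gcongr; linarith
      _ = 3 * x ^ c * fzLam c k := by ring
      _ ≤ _ := le_add_of_nonneg_right hsecond
  · push Not at hfar
    rw [abs_lt] at hfar
    have hk2x : (k:ℝ) < 2 * x := by
      have : Real.log k < Real.log (2 * x) := by
        rw [Real.log_mul (by norm_num) (by linarith)]; linarith [hfar.1]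
      exact (Real.log_lt_log_iff (by linarith) (by linarith)).1 this
    have hkx2 : x < 2 * k := by
      have : Real.log x < Real.log (2 * k) := by
        rw [Real.log_mul (by norm_num) (by linarith)]; linarith [hfar.2]
      exact (Real.log_lt_log_iff (by linarith) (by linarith)).1 this
    have hkM : k ∈ Finset.range ⌈2 * x⌉₊ := by
      rw [Finset.mem_range, Nat.lt_ceil]; exact hk2x
    rw [if_pos hkM]
    have hhalf : 1/2 ≤ |x - k| := by
      have h1 := hn.2 k hpp
      have h2 : (1:ℝ) ≤ |(k:ℝ) - n| := by
        have h3 : ((k:ℤ) - (n:ℤ)) ≠ 0 := by omega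
        have h4 := Int.one_le_abs h3
        exact_mod_cast h4
      have h3 : |(k:ℝ) - n| ≤ |x - k| + |x - n| := by
        have := abs_sub (x - n) (x - k)
        have e : (x - n) - (x - k) = (k:ℝ) - n := by ring
        rw [e] at this; linarith
      linarith
    have hlogd := fz_log_diff (by linarith : 0 < x) (by linarith : (0:ℝ) < k) hk2x.le
    have hdp : 0 < |x - k| / (2 * x) := by positivity
    have hne : Real.log x - Real.log k ≠ 0 := by rw [← abs_pos]; linarith
    have h1 := fzK_bound hne b b'
    have hfl : |(k:ℝ) - (⌊x⌋₊:ℕ)| + 1 ≤ 5 * |x - k| := by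
      have a1 := Nat.floor_le (by linarith : 0 ≤ x)
      have a2 := Nat.lt_floor_add_one x
      have a3 : |(k:ℝ) - (⌊x⌋₊:ℕ)| ≤ |x - k| + 1 := by
        have := abs_sub_comm x k
        rw [this]
        have := abs_add_le ((k:ℝ) - x) (x - (⌊x⌋₊:ℕ))
        rw [abs_of_nonneg (by linarith : 0 ≤ x - (⌊x⌋₊:ℕ))] at this
        have e : (k:ℝ) - x + (x - (⌊x⌋₊:ℕ)) = (k:ℝ) - (⌊x⌋₊:ℕ) := by ring
        rw [e] at this; linarith
      linarith
    have h2 : ‖fzK (Real.log x - Real.log k) b b'‖ ≤ 20 * x * (1 / (|(k:ℝ) - (⌊x⌋₊:ℕ)| + 1)) := by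
      refine h1.trans ?_
      calc 2 / |Real.log x - Real.log k| ≤ 2 / (|x - k| / (2 * x)) := by gcongr
        _ = 20 * x * (1 / (5 * |x - k|)) := by
          have : 0 < |x - k| := by linarith
          field_simp; ring
        _ ≤ _ := by gcongr
    have h3 : x ^ c * fzLam c k ≤ 4 * Real.log (3 * x) := by
      unfold fzLam
      have a1 : x ^ c * (k:ℝ)^(-c) ≤ 4 := by
        rw [Real.rpow_neg (by linarith), ← div_eq_mul_inv, ← Real.div_rpow (by linarith) (by linarith)]
        calc (x / k)^c ≤ (2:ℝ)^c := by
              apply Real.rpow_le_rpow (by positivity) _ (by linarith)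
              rw [div_le_iff₀ (by linarith)]; linarith
          _ ≤ (2:ℝ)^(2:ℝ) := Real.rpow_le_rpow_of_exponent_le (by norm_num) hc2
          _ = 4 := by norm_num
      have a2 : ArithmeticFunction.vonMangoldt k ≤ Real.log (3 * x) :=
        ArithmeticFunction.vonMangoldt_le_log.trans (Real.log_le_log (by linarith) (by linarith))
      have a3 : 0 ≤ ArithmeticFunction.vonMangoldt k := ArithmeticFunction.vonMangoldt_nonneg
      calc _ = (x ^ c * (k:ℝ)^(-c)) * ArithmeticFunction.vonMangoldt k := by ring
        _ ≤ 4 * Real.log (3 * x) := by gcongr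
    calc _ = (x ^ c * fzLam c k) * ‖fzK (Real.log x - Real.log k) b b'‖ := by ring
      _ ≤ (4 * Real.log (3 * x)) * (20 * x * (1 / (|(k:ℝ) - (⌊x⌋₊:ℕ)| + 1))) := by gcongr
      _ = 80 * x * Real.log (3 * x) * (1 / (|(k:ℝ) - (⌊x⌋₊:ℕ)| + 1)) := by ring
      _ ≤ _ := le_add_of_nonneg_left hfirst

lemma fz_right : ∃ C > 0, ∀ x : ℝ, 1 < x → ∀ n : ℕ, fzNear x n → ∀ b b' T : ℝ, 0 ≤ b → b ≤ 4 → T ≤ b' → b' ≤ T + 1 →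
    ‖((x ^ (fzc x) : ℝ) : ℂ) * (∫ y in b..b', fzLS (fzc x + (1 * y : ℝ) * I) * Complex.exp ((I * (Real.log x : ℝ)) * y))
      - (ArithmeticFunction.vonMangoldt n : ℂ) * fzK (Real.log (x / n)) 0 T‖ ≤ C * (x * Real.log (3 * x) ^ 2) := by
  obtain ⟨C, hC, hLam⟩ := fzLam_tsum
  refine ⟨21 + 9 * C + 320, by positivity, fun x hx n hn b b' T hb hb4 hT hT1 => ?_⟩
  have hc1 := fzc_gt hx
  have hc2 := fzc_le hx
  have hl3 := fz_log3x hx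
  set F : ℕ → ℂ := fun k => ((x ^ (fzc x) : ℝ) : ℂ) * ((fzLam (fzc x) k : ℂ) * fzK (Real.log x - 1 * Real.log k) b b') with hF
  have hsum : HasSum F _ := (fz_dir (ε := 1) (b := b) (b' := b') (x := x) hc1).mul_left ((x ^ (fzc x) : ℝ) : ℂ)
  set S := ((x ^ (fzc x) : ℝ) : ℂ) * (∫ y in b..b', fzLS (fzc x + (1 * y : ℝ) * I) * Complex.exp ((I * (Real.log x : ℝ)) * y))
  have hsum2 : HasSum (fun k => F k - (if k = n then F n else 0)) (S - F n) := hsum.sub (hasSum_ite_eq n (F n))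
  have hg1 : HasSum (fun k => 3 * x ^ (fzc x) * fzLam (fzc x) k) (3 * x ^ (fzc x) * ∑' k, fzLam (fzc x) k) :=
    (fzLam_summable hc1).hasSum.mul_left _
  set M := ⌈2 * x⌉₊ with hM
  set B : ℕ → ℝ := fun k => 80 * x * Real.log (3 * x) * (1 / (|(k:ℝ) - (⌊x⌋₊:ℕ)| + 1)) with hB
  have hg2 : HasSum (fun k => if k ∈ Finset.range M then B k else 0) (∑ k ∈ Finset.range M, B k) := by
    have : HasSum (fun k => if k ∈ Finset.range M then B k else 0)
        (∑ k ∈ Finset.range M, if k ∈ Finset.range M then B k else 0) :=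
      hasSum_sum_of_ne_finset_zero (fun k hk => if_neg hk)
    rwa [Finset.sum_congr rfl (fun k hk => if_pos hk)] at this
  have hbd : ‖S - F n‖ ≤ 3 * x ^ (fzc x) * ∑' k, fzLam (fzc x) k + ∑ k ∈ Finset.range M, B k := by
    rw [← hsum2.tsum_eq]
    refine tsum_of_norm_bounded (hg1.add hg2) (fun k => ?_)
    by_cases hk : k = n
    · rw [if_pos hk, hk, sub_self, norm_zero]
      have h1 := fzLam_nonneg (fzc x) n
      apply add_nonneg
      · positivity
      · split_ifs
        · rw [hB]; positivity
        · exact le_rfl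
    · rw [if_neg hk, sub_zero]
      exact fz_other_term hx hn b b' k hk
  have hB1 : ∑ k ∈ Finset.range M, B k ≤ 320 * (x * Real.log (3 * x) ^ 2) := by
    rw [hB, ← Finset.mul_sum]
    have h1 := fz_harm ⌊x⌋₊ M
    have h2 := harmonic_le_one_add_log ⌊x⌋₊
    have h3 := harmonic_le_one_add_log M
    have h4 : Real.log (⌊x⌋₊:ℕ) ≤ Real.log (3 * x) := by
      have a0 : 1 ≤ ⌊x⌋₊ := Nat.le_floor (by simpa using hx.le)
      have a1 := Nat.floor_le (by linarith : 0 ≤ x)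
      apply Real.log_le_log (by positivity) (by linarith)
    have h5 : Real.log M ≤ Real.log (3 * x) := by
      have a1 := Nat.ceil_lt_add_one (by linarith : 0 ≤ 2 * x)
      have a2 := Nat.le_ceil (2 * x)
      apply Real.log_le_log (by linarith) (by linarith)
    calc 80 * x * Real.log (3 * x) * ∑ k ∈ Finset.range M, 1 / (|(k:ℝ) - (⌊x⌋₊:ℕ)| + 1)
        ≤ 80 * x * Real.log (3 * x) * (4 * Real.log (3 * x)) := by gcongr; linarith
      _ = _ := by ring
  have hA1 : 3 * x ^ (fzc x) * ∑' k, fzLam (fzc x) k ≤ 9 * C * (x * Real.log (3 * x) ^ 2) := by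
    have h1 := hLam (fzc x) hc1 hc2
    have h2 : C / (fzc x - 1) = C * Real.log (3 * x) := by
      unfold fzc; rw [add_sub_cancel_left]; field_simp
    rw [h2] at h1
    have h3 := fzc_pow hx
    calc _ ≤ 3 * (3 * x) * (C * Real.log (3 * x)) := by
          have : 0 ≤ ∑' k, fzLam (fzc x) k := tsum_nonneg (fzLam_nonneg _)
          gcongr
      _ = 9 * C * (x * (1 * Real.log (3 * x))) := by ring
      _ ≤ 9 * C * (x * (Real.log (3 * x) * Real.log (3 * x))) := by gcongr
      _ = _ := by ring
  have hn1 := fz_near_term hx hn hb hb4 hT hT1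
  have hn2 : 21 * x * Real.log (3 * x) ≤ 21 * (x * Real.log (3 * x) ^ 2) := by
    have : Real.log (3 * x) ≤ Real.log (3 * x) ^ 2 := by nlinarith
    nlinarith
  have e : S - (ArithmeticFunction.vonMangoldt n : ℂ) * fzK (Real.log (x / n)) 0 T =
    (S - F n) + (F n - (ArithmeticFunction.vonMangoldt n : ℂ) * fzK (Real.log (x / n)) 0 T) := by ring
  rw [e]
  refine (norm_add_le _ _).trans ?_
  have hn3 : ‖F n - (ArithmeticFunction.vonMangoldt n : ℂ) * fzK (Real.log (x / n)) 0 T‖ ≤ 21 * x * Real.log (3 * x) := hn1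
  linarith

lemma fz_left : ∃ C > 0, ∀ x : ℝ, 1 < x → ∀ b b' : ℝ,
    ‖∫ y in b..b', fzLS (fzc x + (-1 * y : ℝ) * I) * Complex.exp ((I * (Real.log x : ℝ)) * y)‖ ≤ C * Real.log (3 * x) := by
  obtain ⟨C, hC, hLam⟩ := fzLam_tsum
  refine ⟨3 * C, by positivity, fun x hx b b' => ?_⟩
  have hc1 := fzc_gt hx
  have hc2 := fzc_le hx
  have hl3 := fz_log3x hx
  have h := fz_dir (ε := -1) (b := b) (b' := b') (x := x) hc1
  rw [← h.tsum_eq]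
  have h1 := hLam (fzc x) hc1 hc2
  have h2 : C / (fzc x - 1) = C * Real.log (3 * x) := by
    unfold fzc; rw [add_sub_cancel_left]; field_simp
  rw [h2] at h1
  refine (tsum_of_norm_bounded ((fzLam_summable hc1).hasSum.mul_left 3) (fun k => ?_)).trans (by linarith)
  have hL := fzLam_nonneg (fzc x) k
  rw [norm_mul, Complex.norm_real, Real.norm_eq_abs, abs_of_nonneg hL, mul_comm]
  by_cases hk : k < 2
  · have : ArithmeticFunction.vonMangoldt k = 0 := by
      interval_cases k <;> simp
    have : fzLam (fzc x) k = 0 := by unfold fzLam; rw [this, zero_mul]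
    rw [this]; simp
  · gcongr
    have hk2 : (2:ℝ) ≤ k := by exact_mod_cast not_lt.1 hk
    have a1 := Real.log_le_log (by norm_num) hk2
    have a2 := Real.log_pos hx
    have a3 := Real.log_two_gt_d9
    have hp : Real.log 2 ≤ Real.log x - -1 * Real.log k := by linarith
    refine (fzK_bound (by linarith) b b').trans ?_
    rw [abs_of_pos (by linarith), div_le_iff₀ (by linarith)]
    linarith

lemma fz_line_re (c t : ℝ) : ((c:ℂ) + (t:ℝ) * I).re = c := by simp

lemma fz_vert {c ε b b' x : ℝ} (hc : 1 < c) :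
    ∫ y in b..b', logDeriv fzXi (c + (ε * y : ℝ) * I) * Complex.exp ((I * (Real.log x : ℝ)) * y) =
      (∫ y in b..b', fzA2 (c + (ε * y : ℝ) * I) * Complex.exp ((I * (Real.log x : ℝ)) * y)) -
      ∫ y in b..b', fzLS (c + (ε * y : ℝ) * I) * Complex.exp ((I * (Real.log x : ℝ)) * y) := by
  have hline : Continuous (fun y : ℝ => (c:ℂ) + (ε * y : ℝ) * I) := by fun_prop
  have hre : ∀ y : ℝ, 1 < ((c:ℂ) + (ε * y : ℝ) * I).re := fun y => by rw [fz_line_re]; exact hc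
  have hA : Continuous (fun y : ℝ => fzA2 (c + (ε * y : ℝ) * I)) := by
    rw [continuous_iff_continuousAt]
    intro y
    exact ContinuousAt.comp (f := fun y : ℝ => (c:ℂ) + (ε * y : ℝ) * I) (g := fzA2)
      (fzA2_hasDeriv (hre y)).continuousAt hline.continuousAt
  have hL : Continuous (fun y : ℝ => logDeriv fzXi (c + (ε * y : ℝ) * I)) := by
    unfold logDeriv
    apply Continuous.div
    · exact ((fzXi_diff.contDiff (n := 1)).continuous_deriv le_rfl).comp hline
    · exact fzXi_diff.continuous.comp hline
    · intro y; exact fzXi_ne_right (hre y).le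
  have hS : (fun y : ℝ => fzLS (c + (ε * y : ℝ) * I)) =
      fun y : ℝ => fzA2 (c + (ε * y : ℝ) * I) - logDeriv fzXi (c + (ε * y : ℝ) * I) := by
    funext y; rw [fz_logDeriv_xi (hre y)]; ring
  have hSc : Continuous (fun y : ℝ => fzLS (c + (ε * y : ℝ) * I)) := by rw [hS]; exact hA.sub hL
  have he : Continuous (fun y : ℝ => Complex.exp ((I * (Real.log x : ℝ)) * y)) := by fun_prop
  refine Eq.trans ?_ (intervalIntegral.integral_sub ((hA.mul he).intervalIntegrable _ _) ((hSc.mul he).intervalIntegrable _ _))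
  refine intervalIntegral.integral_congr (fun y _ => ?_)
  rw [fz_logDeriv_xi (hre y)]; ring

lemma fz_cpow {x : ℝ} (hx : 0 < x) (c y : ℝ) :
    (x:ℂ) ^ ((c:ℂ) + y * I) = ((x ^ c : ℝ) : ℂ) * Complex.exp ((I * (Real.log x : ℝ)) * y) := by
  have hx0 : (x:ℂ) ≠ 0 := by exact_mod_cast hx.ne'
  rw [Complex.cpow_add _ _ hx0, Complex.ofReal_cpow hx.le, Complex.cpow_def_of_ne_zero hx0 ((y:ℂ) * I),
    Complex.ofReal_log hx.le]
  congr 2; ring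

lemma fz_sum_formula {x c b b' : ℝ} (hx : 0 < x) (hc : 1 < c) (hb : b < b')
    (hbot : ∀ σ ∈ Icc (1-c) c, fzXi (σ + b * I) ≠ 0) (htop : ∀ σ ∈ Icc (1-c) c, fzXi (σ + b' * I) ≠ 0) :
    2 * π * I * ∑ ρ ∈ fzZ b b', (fzm ρ : ℂ) * (x:ℂ)^ρ =
      (∫ u in (1-c)..c, (x:ℂ)^(u + b * I : ℂ) * logDeriv fzXi (u + b * I)) -
      (∫ u in (1-c)..c, (x:ℂ)^(u + b' * I : ℂ) * logDeriv fzXi (u + b' * I)) +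
      I * (((x^c : ℝ) : ℂ) * ∫ y in b..b', logDeriv fzXi (c + (1 * y : ℝ) * I) * Complex.exp ((I * (Real.log x : ℝ)) * y)) +
      I * (((x^(1-c) : ℝ) : ℂ) * ∫ y in b..b', logDeriv fzXi (c + (-1 * y : ℝ) * I) * Complex.exp ((I * (Real.log x : ℝ)) * y)) := by
  rw [← fz_rect_residue hx (by linarith) hc.le hb hbot htop]
  unfold fzRect
  have h1 : (∫ y in b..b', (x:ℂ)^((c:ℂ) + y * I) * logDeriv fzXi (c + y * I)) =
      ((x^c : ℝ) : ℂ) * ∫ y in b..b', logDeriv fzXi (c + (1 * y : ℝ) * I) * Complex.exp ((I * (Real.log x : ℝ)) * y) := by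
    rw [← intervalIntegral.integral_const_mul]
    refine intervalIntegral.integral_congr (fun y _ => ?_)
    rw [fz_cpow hx, one_mul]; ring
  have h2 : (∫ y in b..b', (x:ℂ)^(((1 - c : ℝ):ℂ) + y * I) * logDeriv fzXi (((1 - c : ℝ):ℂ) + y * I)) =
      -(((x^(1-c) : ℝ) : ℂ) * ∫ y in b..b', logDeriv fzXi (c + (-1 * y : ℝ) * I) * Complex.exp ((I * (Real.log x : ℝ)) * y)) := by
    rw [← intervalIntegral.integral_const_mul, ← intervalIntegral.integral_neg]
    refine intervalIntegral.integral_congr (fun y _ => ?_)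
    rw [fz_cpow hx]
    have : ((1 - c : ℝ):ℂ) + y * I = 1 - (c + (-1 * y : ℝ) * I) := by push_cast; ring
    rw [this, fzXi_logDeriv_symm]; ring
  rw [h1, h2]
  ring

lemma fz_hor_bound {x c b B : ℝ} (hx : 1 < x) (hc : 1 < c) (hc2 : c ≤ 2) (hB : 0 ≤ B) (hxc : x ^ c ≤ 3 * x)
    (h : ∀ σ ∈ Icc (-1:ℝ) 2, ‖logDeriv fzXi (σ + b * I)‖ ≤ B) :
    ‖∫ u in (1-c)..c, (x:ℂ)^(u + b * I : ℂ) * logDeriv fzXi (u + b * I)‖ ≤ 9 * x * B := by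
  have h1 := intervalIntegral.norm_integral_le_of_norm_le_const (a := 1-c) (b := c) (C := 3 * x * B)
    (f := fun u : ℝ => (x:ℂ)^(u + b * I : ℂ) * logDeriv fzXi (u + b * I)) (fun u hu => by
      rw [uIoc_of_le (by linarith)] at hu
      rw [norm_mul]
      have h2 := h u ⟨by linarith [hu.1], by linarith [hu.2]⟩
      have h3 : ‖(x:ℂ)^(u + b * I : ℂ)‖ ≤ 3 * x := by
        rw [Complex.norm_cpow_eq_rpow_re_of_pos (by linarith), fz_line_re]
        exact (Real.rpow_le_rpow_of_exponent_le hx.le hu.2).trans hxc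
      gcongr)
  refine h1.trans ?_
  rw [abs_of_nonneg (by linarith)]
  nlinarith [mul_nonneg (by linarith : (0:ℝ) ≤ 3 * x) hB]

lemma fz_inv_log {x T : ℝ} (hx : 1 < x) (hT : 5 ≤ T) :
    x * (Real.log (2 * T) / Real.log x) ≤ 2 * (x * Real.log (2 * x * T) ^ 2 + Real.log (2 * T) / Real.log x) := by
  have hlx : 0 < Real.log x := Real.log_pos hx
  have hlT : 1 ≤ Real.log (2 * T) := by
    rw [Real.le_log_iff_exp_le (by linarith)]; linarith [Real.exp_one_lt_d9]
  have hL : Real.log (2 * T) ≤ Real.log (2 * x * T) := Real.log_le_log (by linarith) (by nlinarith)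
  have hq : 0 < Real.log (2 * T) / Real.log x := by positivity
  rcases le_total x 2 with h | h
  · have : x * (Real.log (2 * T) / Real.log x) ≤ 2 * (Real.log (2 * T) / Real.log x) := by gcongr
    have : 0 ≤ x * Real.log (2 * x * T) ^ 2 := by positivity
    linarith
  · have h1 : 1/2 ≤ Real.log x := by
      have := Real.log_le_log (by norm_num) h
      linarith [Real.log_two_gt_d9]
    have h2 : Real.log (2 * T) / Real.log x ≤ 2 * Real.log (2 * x * T) ^ 2 := by
      rw [div_le_iff₀ hlx]
      nlinarith [mul_nonneg (sq_nonneg (Real.log (2 * x * T))) (by linarith : 0 ≤ Real.log x - 1/2)]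
    have : x * (Real.log (2 * T) / Real.log x) ≤ x * (2 * Real.log (2 * x * T) ^ 2) := by gcongr
    linarith

set_option maxHeartbeats 1000000 in
lemma fz_core : ∃ C > 0, ∃ b ∈ Icc (3:ℝ) 4, ∀ x T : ℝ, 1 < x → 5 ≤ T → ∀ n, fzNear x n →
    ∃ T' ∈ Icc T (T+1),
    ‖(∑ ρ ∈ fzZ b T', (fzm ρ : ℂ) * (x:ℂ)^ρ) +
      (ArithmeticFunction.vonMangoldt n : ℂ) / (2 * π) * fzK (Real.log (x / n)) 0 T‖ ≤
      C * (x * Real.log (2 * x * T) ^ 2 + Real.log (2 * T) / Real.log x) := by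
  obtain ⟨Ch, hCh, hhor⟩ := fz_hor
  obtain ⟨Ca, hCa, harch⟩ := fz_arch
  obtain ⟨Cr, hCr, hright⟩ := fz_right
  obtain ⟨Cl, hCl, hleft⟩ := fz_left
  obtain ⟨b, hb, hbh⟩ := hhor 3 le_rfl
  refine ⟨18 * Ch + 7 * Ca + Cr + Cl, by positivity, b, ⟨hb.1, by linarith [hb.2]⟩, fun x T hx hT n hn => ?_⟩
  obtain ⟨T', hT', hth⟩ := hhor T (by linarith)
  refine ⟨T', hT', ?_⟩
  have hb1 := hb.1
  have hb2 := hb.2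
  have hT1 := hT'.1
  have hT2 := hT'.2
  have hc1 := fzc_gt hx
  have hc2 := fzc_le hx
  have hxc := fzc_pow hx
  set c := fzc x with hcdef
  have hsub : ∀ σ ∈ Icc (1-c) c, σ ∈ Icc (-1:ℝ) 2 := fun σ hσ => ⟨by linarith [hσ.1], by linarith [hσ.2]⟩
  have hform := fz_sum_formula (x := x) (c := c) (b := b) (b' := T') (by linarith) hc1 (by linarith)
    (fun σ hσ => (hbh σ (hsub σ hσ)).1) (fun σ hσ => (hth σ (hsub σ hσ)).1)
  rw [fz_vert hc1, fz_vert hc1] at hform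
  have hlx : 0 < Real.log x := Real.log_pos hx
  have hlT : 1 ≤ Real.log (2 * T) := by
    rw [Real.le_log_iff_exp_le (by linarith)]; linarith [Real.exp_one_lt_d9]
  have hL : Real.log (2 * T) ≤ Real.log (2 * x * T) := Real.log_le_log (by linarith) (by nlinarith)
  have hl3 := fz_log3x hx
  have hL3 : Real.log (3 * x) ≤ Real.log (2 * x * T) := Real.log_le_log (by linarith) (by nlinarith)
  have hinv := fz_inv_log hx hT
  have hH1 := fz_hor_bound (x := x) (c := c) (b := b) (B := Ch * Real.log 3 ^ 2) hx hc1 hc2 (by positivity) hxc (fun σ hσ => (hbh σ hσ).2)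
  have hH2 := fz_hor_bound (x := x) (c := c) (b := T') (B := Ch * Real.log T ^ 2) hx hc1 hc2 (by positivity) hxc (fun σ hσ => (hth σ hσ).2)
  have hA1 := harch c 1 b T' x hc1 hc2 (by simp) hb1 (by linarith) hx
  have hA2 := harch c (-1) b T' x hc1 hc2 (by simp) hb1 (by linarith) hx
  have hR := hright x hx n hn b T' T (by linarith) (by linarith) hT1 hT2
  have hLf := hleft x hx b T'
  rw [← hcdef] at hR hLf
  set H1 := ∫ u in (1-c)..c, (x:ℂ)^(u + b * I : ℂ) * logDeriv fzXi (u + b * I)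
  set H2 := ∫ u in (1-c)..c, (x:ℂ)^(u + T' * I : ℂ) * logDeriv fzXi (u + T' * I)
  set A1 := ∫ y in b..T', fzA2 (c + (1 * y : ℝ) * I) * Complex.exp ((I * (Real.log x : ℝ)) * y)
  set A2 := ∫ y in b..T', fzA2 (c + (-1 * y : ℝ) * I) * Complex.exp ((I * (Real.log x : ℝ)) * y)
  set R1 := ∫ y in b..T', fzLS (c + (1 * y : ℝ) * I) * Complex.exp ((I * (Real.log x : ℝ)) * y)
  set R2 := ∫ y in b..T', fzLS (c + (-1 * y : ℝ) * I) * Complex.exp ((I * (Real.log x : ℝ)) * y)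
  set S := ∑ ρ ∈ fzZ b T', (fzm ρ : ℂ) * (x:ℂ)^ρ
  set K := fzK (Real.log (x / n)) 0 T
  set L := Real.log (2 * x * T)
  set Q := Real.log (2 * T) / Real.log x
  have hQ : 0 < Q := by positivity
  have hpi : (π:ℂ) ≠ 0 := by exact_mod_cast Real.pi_ne_zero
  have hkey : S + (ArithmeticFunction.vonMangoldt n : ℂ) / (2 * π) * K =
      (H1 - H2 + I * (((x^c : ℝ) : ℂ) * A1) + I * (((x^(1-c) : ℝ) : ℂ) * A2) - I * (((x^(1-c) : ℝ) : ℂ) * R2)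
        - I * (((x^c : ℝ) : ℂ) * R1 - (ArithmeticFunction.vonMangoldt n : ℂ) * K)) / (2 * π * I) := by
    rw [eq_div_iff (by simp [hpi])]
    have : (S + (ArithmeticFunction.vonMangoldt n : ℂ) / (2 * π) * K) * (2 * π * I) = 2 * π * I * S + I * ((ArithmeticFunction.vonMangoldt n : ℂ) * K) := by
      field_simp
    rw [this, hform]; ring
  have hxl : x ^ (1 - c) ≤ 1 := Real.rpow_le_one_of_one_le_of_nonpos hx.le (by linarith)
  have hxl0 : 0 < x ^ (1-c) := Real.rpow_pos_of_pos (by linarith) _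
  have hxc0 : 0 < x ^ c := Real.rpow_pos_of_pos (by linarith) _
  have hlT' : Real.log T' ≤ Real.log (2 * T) := Real.log_le_log (by linarith) (by linarith)
  have hTL : Real.log T ≤ L := (Real.log_le_log (by linarith) (by linarith)).trans hL
  have hlT0 : 0 ≤ Real.log T := Real.log_nonneg (by linarith)
  have h3L : Real.log 3 ≤ L := (Real.log_le_log (by norm_num) (by linarith)).trans hTL
  have h30 : 0 ≤ Real.log 3 := Real.log_nonneg (by norm_num)
  have e1 : ‖H1‖ ≤ 9 * x * (Ch * L ^ 2) := hH1.trans (by gcongr)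
  have e2 : ‖H2‖ ≤ 9 * x * (Ch * L ^ 2) := hH2.trans (by gcongr)
  have hAq : Ca * Real.log T' / Real.log x ≤ Ca * Q := by
    rw [mul_div_assoc]
    have : Real.log T' / Real.log x ≤ Q := div_le_div_of_nonneg_right hlT' hlx.le
    gcongr
  have e3 : ‖I * (((x^c : ℝ) : ℂ) * A1)‖ ≤ 3 * x * (Ca * Q) := by
    rw [norm_mul, Complex.norm_I, one_mul, norm_mul, Complex.norm_real, Real.norm_of_nonneg hxc0.le]
    have := hA1.trans hAq
    gcongr
  have e4 : ‖I * (((x^(1-c) : ℝ) : ℂ) * A2)‖ ≤ 1 * (Ca * Q) := by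
    rw [norm_mul, Complex.norm_I, one_mul, norm_mul, Complex.norm_real, Real.norm_of_nonneg hxl0.le]
    have := hA2.trans hAq
    gcongr
  have hL1 : 1 ≤ L := hlT.trans hL
  have hLL : L ≤ x * L ^ 2 := by nlinarith
  have e5 : ‖I * (((x^(1-c) : ℝ) : ℂ) * R2)‖ ≤ 1 * (Cl * (x * L^2)) := by
    rw [norm_mul, Complex.norm_I, one_mul, norm_mul, Complex.norm_real, Real.norm_of_nonneg hxl0.le]
    have : ‖R2‖ ≤ Cl * (x * L ^ 2) := hLf.trans (mul_le_mul_of_nonneg_left (hL3.trans hLL) hCl.le)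
    gcongr
  have e6 : ‖I * (((x^c : ℝ) : ℂ) * R1 - (ArithmeticFunction.vonMangoldt n : ℂ) * K)‖ ≤ Cr * (x * L ^ 2) := by
    rw [norm_mul, Complex.norm_I, one_mul]
    exact hR.trans (by gcongr)
  have hden : (1:ℝ) ≤ ‖(2 * π * I : ℂ)‖ := by
    simp [abs_of_pos Real.pi_pos]
    linarith [Real.pi_gt_three]
  rw [hkey, norm_div]
  refine (div_le_self (norm_nonneg _) hden).trans ?_
  have ht : ‖H1 - H2 + I * (((x^c : ℝ) : ℂ) * A1) + I * (((x^(1-c) : ℝ) : ℂ) * A2) - I * (((x^(1-c) : ℝ) : ℂ) * R2)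
        - I * (((x^c : ℝ) : ℂ) * R1 - (ArithmeticFunction.vonMangoldt n : ℂ) * K)‖ ≤
      ‖H1‖ + ‖H2‖ + ‖I * (((x^c : ℝ) : ℂ) * A1)‖ + ‖I * (((x^(1-c) : ℝ) : ℂ) * A2)‖ + ‖I * (((x^(1-c) : ℝ) : ℂ) * R2)‖
        + ‖I * (((x^c : ℝ) : ℂ) * R1 - (ArithmeticFunction.vonMangoldt n : ℂ) * K)‖ := by
    refine (norm_sub_le _ _).trans (add_le_add_left ?_ _)
    refine (norm_sub_le _ _).trans (add_le_add_left ?_ _)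
    refine (norm_add_le _ _).trans (add_le_add_left ?_ _)
    refine (norm_add_le _ _).trans (add_le_add_left ?_ _)
    exact norm_sub_le _ _
  have hxL : 0 ≤ x * L ^ 2 := by positivity
  have f1 : Ca * (x * Q) ≤ Ca * (2 * (x * L ^ 2 + Q)) := by gcongr
  refine ht.trans ?_
  have k1 := mul_nonneg hCh.le hQ.le
  have k2 := mul_nonneg hCr.le hQ.le
  have k3 := mul_nonneg hCl.le hQ.le
  have k4 := mul_nonneg hCa.le hxL
  clear_value Q L
  clear ht hkey hform
  linarith

lemma fz_main_term {x T : ℝ} (hx : 1 < x) {n : ℕ} (hn : n ≠ 0) :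
    (if x = (n : ℝ) then -((T : ℂ) * (ArithmeticFunction.vonMangoldt n : ℝ)) / (2 * π)
           else -((ArithmeticFunction.vonMangoldt n : ℝ) / (2 * (π : ℂ))) *
             (Complex.exp (Complex.I * T * Real.log (x / n)) - 1) /
               (Complex.I * Real.log (x / n))) =
      -((ArithmeticFunction.vonMangoldt n : ℂ) / (2 * π) * fzK (Real.log (x / n)) 0 T) := by
  have hn0 : (0:ℝ) < n := by exact_mod_cast Nat.pos_of_ne_zero hn
  unfold fzK
  split_ifs with h
  · rw [h, div_self hn0.ne']
    simp; ring
  · have hl : Real.log (x / n) ≠ 0 := by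
      apply Real.log_ne_zero_of_pos_of_ne_one (by positivity)
      rw [Ne, div_eq_one_iff_eq hn0.ne']; exact h
    have hl' : I * (Real.log (x/n) : ℂ) ≠ 0 := mul_ne_zero I_ne_zero (by exact_mod_cast hl)
    rw [integral_exp_mul_complex hl']
    have : I * (T:ℂ) * (Real.log (x/n) : ℂ) = I * (Real.log (x/n) : ℂ) * T := by ring
    rw [this]; simp; ring

lemma fz_finsum (x T : ℝ) : (∑ᶠ ρ ∈ zetaZerosUpTo T, (zetaZeroMult ρ : ℂ) * (x : ℂ) ^ ρ) =
    ∑ ρ ∈ (fzZ 0 T).filter (fun ρ : ℂ => 0 < ρ.im), (fzm ρ : ℂ) * (x:ℂ)^ρ := by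
  have h : zetaZerosUpTo T = ((fzZ 0 T).filter (fun ρ : ℂ => 0 < ρ.im) : Finset ℂ) := by
    ext ρ
    simp only [zetaZerosUpTo, Set.mem_ofPred_eq, Finset.coe_filter, mem_fzZ, fzXi_zero_iff]
    constructor
    · rintro ⟨h1, h2, h3, h4, h5⟩; exact ⟨⟨⟨h1, h2, h3⟩, h4.le, h5⟩, h4⟩
    · rintro ⟨⟨⟨h1, h2, h3⟩, -, h5⟩, h4⟩; exact ⟨h1, h2, h3, h4, h5⟩
  rw [h, finsum_mem_coe_finset]
  refine Finset.sum_congr rfl (fun ρ hρ => ?_)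
  have := (fzXi_zero_iff.1 (mem_fzZ.1 (Finset.mem_filter.1 hρ).1).1).2
  rw [fzXi_mult this.1 this.2, fzm]

lemma fz_sum_triv {x : ℝ} (hx : 1 < x) {s t : Finset ℂ} (hs : ∀ ρ ∈ s, fzXi ρ = 0) (hst : s ⊆ t) :
    ‖∑ ρ ∈ s, (fzm ρ : ℂ) * (x:ℂ)^ρ‖ ≤ x * ∑ ρ ∈ t, (fzm ρ : ℝ) := by
  refine (norm_sum_le _ _).trans ?_
  rw [Finset.mul_sum]
  refine le_trans ?_ (Finset.sum_le_sum_of_subset_of_nonneg hst (fun ρ _ _ => by positivity))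
  refine Finset.sum_le_sum (fun ρ hρ => ?_)
  rw [norm_mul, Complex.norm_natCast, Complex.norm_cpow_eq_rpow_re_of_pos (by linarith), mul_comm]
  have h1 := (fzXi_zero_re (hs ρ hρ)).2
  have : x ^ ρ.re ≤ x := by
    calc x ^ ρ.re ≤ x ^ (1:ℝ) := Real.rpow_le_rpow_of_exponent_le hx.le h1.le
      _ = x := Real.rpow_one x
  gcongr

lemma fz_final : ∃ C > 0, ∀ x T : ℝ, 1 < x → 1 < T → ∀ n, fzNear x n →
    ‖(∑ ρ ∈ (fzZ 0 T).filter (fun ρ : ℂ => 0 < ρ.im), (fzm ρ : ℂ) * (x:ℂ)^ρ) +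
      (ArithmeticFunction.vonMangoldt n : ℂ) / (2 * π) * fzK (Real.log (x / n)) 0 T‖ ≤
      C * (x * Real.log (2 * x * T) ^ 2 + Real.log (2 * T) / Real.log x) := by
  obtain ⟨C1, hC1, b, hb, hcore⟩ := fz_core
  obtain ⟨C2, hC2, hcount⟩ := fz_count_strip
  set D : ℝ := ∑ ρ ∈ fzZ 0 5, (fzm ρ : ℝ) with hD
  have hD0 : 0 ≤ D := by positivity
  refine ⟨C1 + C2 + 4 * D + 20, by positivity, fun x T hx hT n hn => ?_⟩
  have hlx : 0 < Real.log x := Real.log_pos hx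
  have hlT : 0 < Real.log (2 * T) := Real.log_pos (by linarith)
  have hQ : 0 < Real.log (2 * T) / Real.log x := by positivity
  have hL2 : Real.log 2 ≤ Real.log (2 * x * T) := Real.log_le_log (by norm_num) (by nlinarith)
  have hLh : 1/2 ≤ Real.log (2 * x * T) := by linarith [Real.log_two_gt_d9]
  have hLsq : 1/4 ≤ Real.log (2 * x * T) ^ 2 := by nlinarith
  have hxL : x ≤ 4 * (x * Real.log (2 * x * T) ^ 2) := by nlinarith
  set s := (fzZ 0 T).filter (fun ρ : ℂ => 0 < ρ.im) with hs
  have hszero : ∀ ρ ∈ s, fzXi ρ = 0 := fun ρ hρ => (mem_fzZ.1 (Finset.mem_filter.1 hρ).1).1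
  rcases lt_or_ge T 5 with h5 | h5
  · have hsub : s ⊆ fzZ 0 5 := by
      intro ρ hρ
      have := mem_fzZ.1 (Finset.mem_filter.1 hρ).1
      exact mem_fzZ.2 ⟨this.1, this.2.1, by linarith [this.2.2]⟩
    have h1 := fz_sum_triv hx hszero hsub
    have h2 := fzK_triv (Real.log (x / n)) 0 T (by linarith)
    have h3 : ArithmeticFunction.vonMangoldt n ≤ Real.log (2 * x * T) := by
      refine ArithmeticFunction.vonMangoldt_le_log.trans ?_
      have hn0 : (0:ℝ) < n := by exact_mod_cast Nat.pos_of_ne_zero hn.1.ne_zero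
      apply Real.log_le_log hn0
      have := fzNear_le hx hn
      nlinarith
    have h30 : 0 ≤ ArithmeticFunction.vonMangoldt n := ArithmeticFunction.vonMangoldt_nonneg
    have h4 : ‖(ArithmeticFunction.vonMangoldt n : ℂ) / (2 * π) * fzK (Real.log (x / n)) 0 T‖ ≤ Real.log (2 * x * T) * 5 := by
      rw [norm_mul, norm_div, Complex.norm_real, Real.norm_of_nonneg h30]
      have hden : (1:ℝ) ≤ ‖(2 * π : ℂ)‖ := by
        simp [abs_of_pos Real.pi_pos]
        linarith [Real.pi_gt_three]
      have := (div_le_self h30 hden).trans h3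
      have h6 : ‖fzK (Real.log (x / n)) 0 T‖ ≤ 5 := by linarith
      gcongr
    have h7 : Real.log (2 * x * T) ≤ 2 * (x * Real.log (2 * x * T) ^ 2) := by
      have : Real.log (2 * x * T) ≤ 2 * Real.log (2 * x * T) ^ 2 := by nlinarith
      nlinarith
    refine (norm_add_le _ _).trans ?_
    rw [← hD] at h1
    have h8 : x * D ≤ 4 * (x * Real.log (2 * x * T) ^ 2) * D := by gcongr
    have hE : 0 ≤ x * Real.log (2 * x * T) ^ 2 := by positivity
    nlinarith [mul_nonneg hC1.le hQ.le, mul_nonneg hC2.le hQ.le, mul_nonneg hD0 hQ.le, mul_nonneg hC1.le hE, mul_nonneg hC2.le hE]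
  · obtain ⟨T', hT', hcr⟩ := hcore x T hx h5 n hn
    have hb1 := hb.1
    have hb2 := hb.2
    have hT1 := hT'.1
    have hT2 := hT'.2
    set f : ℂ → ℂ := fun ρ => (fzm ρ : ℂ) * (x:ℂ)^ρ with hf
    have hsplit1 : ∑ ρ ∈ s, f ρ = ∑ ρ ∈ s.filter (fun ρ : ℂ => b ≤ ρ.im), f ρ + ∑ ρ ∈ s.filter (fun ρ : ℂ => ¬ b ≤ ρ.im), f ρ :=
      (Finset.sum_filter_add_sum_filter_not s _ f).symm
    have hsplit2 : ∑ ρ ∈ fzZ b T', f ρ = ∑ ρ ∈ (fzZ b T').filter (fun ρ : ℂ => ρ.im ≤ T), f ρ +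
        ∑ ρ ∈ (fzZ b T').filter (fun ρ : ℂ => ¬ ρ.im ≤ T), f ρ :=
      (Finset.sum_filter_add_sum_filter_not _ _ f).symm
    have heq : s.filter (fun ρ : ℂ => b ≤ ρ.im) = (fzZ b T').filter (fun ρ : ℂ => ρ.im ≤ T) := by
      ext ρ
      simp only [hs, Finset.mem_filter, mem_fzZ]
      constructor
      · rintro ⟨⟨⟨h1, h2, h3⟩, h4⟩, h6⟩; exact ⟨⟨h1, h6, by linarith⟩, h3⟩
      · rintro ⟨⟨h1, h2, h3⟩, h4⟩; exact ⟨⟨⟨h1, by linarith, h4⟩, by linarith⟩, h2⟩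
    have g1 : ‖∑ ρ ∈ s.filter (fun ρ : ℂ => ¬ b ≤ ρ.im), f ρ‖ ≤ x * D := by
      refine fz_sum_triv hx (fun ρ hρ => hszero ρ (Finset.mem_filter.1 hρ).1) ?_
      intro ρ hρ
      simp only [hs, Finset.mem_filter, mem_fzZ, not_le] at hρ
      exact mem_fzZ.2 ⟨hρ.1.1.1, hρ.1.1.2.1, by linarith [hρ.2]⟩
    have g2 : ‖∑ ρ ∈ (fzZ b T').filter (fun ρ : ℂ => ¬ ρ.im ≤ T), f ρ‖ ≤ x * ∑ ρ ∈ fzZ T (T+1), (fzm ρ : ℝ) := by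
      refine fz_sum_triv hx (fun ρ hρ => (mem_fzZ.1 (Finset.mem_filter.1 hρ).1).1) ?_
      intro ρ hρ
      simp only [Finset.mem_filter, mem_fzZ, not_le] at hρ
      exact mem_fzZ.2 ⟨hρ.1.1, hρ.2.le, by linarith [hρ.1.2.2]⟩
    have g3 := hcount T (by linarith)
    have hid : ∑ ρ ∈ s, f ρ + (ArithmeticFunction.vonMangoldt n : ℂ) / (2 * π) * fzK (Real.log (x / n)) 0 T =
        (∑ ρ ∈ fzZ b T', f ρ + (ArithmeticFunction.vonMangoldt n : ℂ) / (2 * π) * fzK (Real.log (x / n)) 0 T) +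
        ∑ ρ ∈ s.filter (fun ρ : ℂ => ¬ b ≤ ρ.im), f ρ - ∑ ρ ∈ (fzZ b T').filter (fun ρ : ℂ => ¬ ρ.im ≤ T), f ρ := by
      rw [hsplit1, hsplit2, heq]; ring
    rw [hid]
    refine (norm_sub_le _ _).trans ((add_le_add_left (norm_add_le _ _) _).trans ?_)
    have hTL : Real.log T ≤ Real.log (2 * x * T) := Real.log_le_log (by linarith) (by nlinarith)
    have hLT1 : 1 ≤ Real.log T := by
      rw [Real.le_log_iff_exp_le (by linarith)]; linarith [Real.exp_one_lt_d9]
    have hTL2 : Real.log T ≤ Real.log (2 * x * T) ^ 2 := by nlinarith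
    have g4 : x * ∑ ρ ∈ fzZ T (T+1), (fzm ρ : ℝ) ≤ x * (C2 * Real.log (2 * x * T) ^ 2) := by
      have := g3.trans (mul_le_mul_of_nonneg_left hTL2 hC2.le)
      gcongr
    have g5 : x * D ≤ 4 * (x * Real.log (2 * x * T) ^ 2) * D := by gcongr
    have hE : 0 ≤ x * Real.log (2 * x * T) ^ 2 := by positivity
    nlinarith [mul_nonneg hC2.le hQ.le, mul_nonneg hD0 hQ.le]

open Classical in
/-- Lemma 1 of Ford–Zaharescu: a uniform version of Landau's formula. -/
theorem ford_zaharescu_lem1 :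
    ∃ C : ℝ, 0 < C ∧ ∀ x T : ℝ, 1 < x → 1 < T → ∀ n : ℕ, IsPrimePow n →
      (∀ m : ℕ, IsPrimePow m → |x - (n : ℝ)| ≤ |x - (m : ℝ)|) →
      ‖(∑ᶠ ρ ∈ zetaZerosUpTo T, (zetaZeroMult ρ : ℂ) * (x : ℂ) ^ ρ) -
          (if x = (n : ℝ) then -((T : ℂ) * (ArithmeticFunction.vonMangoldt n : ℝ)) / (2 * π)
           else -((ArithmeticFunction.vonMangoldt n : ℝ) / (2 * (π : ℂ))) *
             (Complex.exp (Complex.I * T * Real.log (x / n)) - 1) /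
               (Complex.I * Real.log (x / n)))‖ ≤
        C * (x * Real.log (2 * x * T) ^ 2 + Real.log (2 * T) / Real.log x) := by
  obtain ⟨C, hC, h⟩ := fz_final
  refine ⟨C, hC, fun x T hx hT n hn hnear => ?_⟩
  have h1 := h x T hx hT n ⟨hn, hnear⟩
  have h2 := fz_main_term (T := T) hx hn.ne_zero
  rw [fz_finsum]
  refine le_trans (le_of_eq ?_) h1
  rw [← sub_neg_eq_add, ← h2]
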